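/- arXiv:1009.0132 — 3 statements merged into one kernel-verified Lean document; each statement's English description precedes it below -/
import Mathlib

section
/- If Γ is a countable amenable group, then every probability-measure-preserving action of Γ on a standard probability space generates a hyperfinite orbit equivalence relation. -/
open MeasureTheory Filter Topology Set ENNReal BoundedContinuousFunction

/-- A **p.m.p. (probability-measure-preserving) countable equivalence relation** on a measure
space `(X, μ)`: a Borel equivalence relation with (at most) countable classes such that every
Borel automorphism of `X` whose graph is contained in the relation preserves `μ`. -/
structure PMPRel (X : Type*) [MeasurableSpace X] (μ : Measure X) where
  /-- the underlying binary relation -/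
  rel : X → X → Prop
  iseqv : Equivalence rel
  measurableSet_rel : MeasurableSet {p : X × X | rel p.1 p.2}
  countable_classes : ∀ x : X, {y : X | rel x y}.Countable
  measure_preserving : ∀ T : X ≃ᵐ X, (∀ x, rel x (T x)) → MeasurePreserving T μ μ

namespace PMPRel

variable {X : Type*} [MeasurableSpace X] {μ : Measure X}

/-- A p.m.p. equivalence relation is **ergodic** if every Borel set which is a union of
classes is null or conull. -/
def IsErgodic (R : PMPRel X μ) : Prop :=
  ∀ A : Set X, MeasurableSet A → (∀ x ∈ A, ∀ y, R.rel x y → y ∈ A) →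
    μ A = 0 ∨ μ Aᶜ = 0

/-- A p.m.p. equivalence relation is **hyperfinite** if, after discarding a null set, it is
the increasing union of a sequence of Borel subrelations all of whose classes are finite. -/
def IsHyperfinite (R : PMPRel X μ) : Prop :=
  ∃ (S : ℕ → X → X → Prop) (X' : Set X),
    μ X'ᶜ = 0 ∧
    (∀ n, Equivalence (S n)) ∧
    (∀ n, MeasurableSet {p : X × X | S n p.1 p.2}) ∧
    (∀ n x, {y : X | S n x y}.Finite) ∧
    (∀ n x y, S n x y → S (n + 1) x y) ∧
    (∀ n x y, S n x y → R.rel x y) ∧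
    (∀ x ∈ X', ∀ y ∈ X', R.rel x y → ∃ n, S n x y)

end PMPRel

/-- A **p.m.p. action** of a group `Γ` on a measure space `(X, μ)`: an action by Borel
automorphisms, each preserving the measure `μ`. -/
structure PMPAction (Γ : Type*) [Group Γ] (X : Type*) [MeasurableSpace X] (μ : Measure X) where
  act : Γ → X → X
  act_one : ∀ x, act 1 x = x
  act_mul : ∀ γ δ x, act (γ * δ) x = act γ (act δ x)
  measurePreserving : ∀ γ, MeasurePreserving (act γ) μ μ

namespace PMPAction

variable {Γ : Type*} [Group Γ] {X : Type*} [MeasurableSpace X] {μ : Measure X}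

/-- A p.m.p. action is **(essentially) free** if every nontrivial group element fixes only a
null set of points. -/
def EssentiallyFree (A : PMPAction Γ X μ) : Prop :=
  ∀ γ : Γ, γ ≠ 1 → μ {x : X | A.act γ x = x} = 0

/-- A p.m.p. action is **ergodic** if every invariant Borel set is null or conull. -/
def IsErgodic (A : PMPAction Γ X μ) : Prop :=
  ∀ B : Set X, MeasurableSet B → (∀ γ, ∀ x ∈ B, A.act γ x ∈ B) → μ B = 0 ∨ μ Bᶜ = 0

/-- A p.m.p. action is **strongly ergodic** if every almost invariant sequence of Borel sets
is trivial, i.e. `μ(Aₙ)(1-μ(Aₙ)) → 0`. -/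
def StronglyErgodic (A : PMPAction Γ X μ) : Prop :=
  ∀ B : ℕ → Set X, (∀ n, MeasurableSet (B n)) →
    (∀ γ : Γ, Tendsto (fun n => μ (symmDiff (B n) (A.act γ '' B n))) atTop (𝓝 0)) →
    Tendsto (fun n => μ (B n) * (1 - μ (B n))) atTop (𝓝 0)

end PMPAction

/-- A group is **amenable** if there is a left-invariant mean on `ℓ^∞(Γ)`, i.e. a positive,
normalized, left-translation-invariant linear functional on the space of bounded (= bounded
continuous for the discrete topology) real-valued functions on `Γ`. -/
def IsAmenable (Γ : Type*) [Group Γ] : Prop :=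
  letI : TopologicalSpace Γ := ⊥
  haveI : DiscreteTopology Γ := ⟨rfl⟩
  ∃ m : (Γ →ᵇ ℝ) →ₗ[ℝ] ℝ,
    (∀ f : Γ →ᵇ ℝ, 0 ≤ f → 0 ≤ m f) ∧
    m 1 = 1 ∧
    ∀ (g : Γ) (f : Γ →ᵇ ℝ),
      m (f.compContinuous ⟨fun x => g * x, continuous_of_discreteTopology⟩) = m f

open scoped NNReal

/-- A countable amenable group satisfies **Reiter's condition**: there are finitely supported
probability vectors on the group that are almost invariant under finitely many translations. -/
theorem IsAmenable.exists_reiter {Γ : Type*} [Group Γ] (hΓ : IsAmenable Γ) (L : Finset Γ)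
    {δ : ℝ} (hδ : 0 < δ) :
    ∃ (T : Finset Γ) (f : Γ → ℝ≥0), (∀ g ∉ T, f g = 0) ∧ ∑ g ∈ T, f g = 1 ∧
      ∑ s ∈ L, ∑ g ∈ T, |(f g : ℝ) - f (s * g)| ≤ δ := by
  classical
  let e : Γ × Γ → lp (fun _ : Γ × Γ => ℝ) 1 := fun i => lp.single 1 i (1 : ℝ)
  let D : Γ → lp (fun _ : Γ × Γ => ℝ) 1 := fun x => ∑ s ∈ L, (e (s, x) - e (s, s⁻¹ * x))
  have h0 : (0 : lp (fun _ : Γ × Γ => ℝ) 1) ∈ closure (convexHull ℝ (range D)) := by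
    by_contra hcon
    obtain ⟨l, u, hl0, hl⟩ := geometric_hahn_banach_point_closed
      (convex_convexHull ℝ (range D)).closure isClosed_closure hcon
    rw [map_zero] at hl0
    let _ : TopologicalSpace Γ := ⊥
    have _ : DiscreteTopology Γ := ⟨rfl⟩
    obtain ⟨m, hpos, hone, hinv⟩ := hΓ
    have hbound : ∀ s g, ‖l (e (s, g))‖ ≤ ‖l‖ := fun s g => by
      have h := l.le_opNorm (e (s, g))
      rwa [lp.norm_single (by simp), norm_one, mul_one] at h
    let F : Γ → (Γ →ᵇ ℝ) := fun s =>
      BoundedContinuousFunction.ofNormedAddCommGroupDiscrete (fun g => l (e (s, g))) ‖l‖ (hbound s)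
    let tr : Γ → (Γ →ᵇ ℝ) → (Γ →ᵇ ℝ) := fun g f =>
      f.compContinuous ⟨fun x => g * x, continuous_of_discreteTopology⟩
    let H : Γ →ᵇ ℝ := ∑ s ∈ L, (F s - tr s⁻¹ (F s))
    have hH : m H = 0 := by
      simp only [H, map_sum, map_sub]
      exact Finset.sum_eq_zero fun s _ => sub_eq_zero.2 (hinv s⁻¹ (F s)).symm
    have hHapp : ∀ g, H g = l (D g) := fun g => by
      simp [H, D, F, tr, BoundedContinuousFunction.coe_sum]
    have hge : 0 ≤ m (H - u • 1) := by
      refine hpos _ fun g => ?_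
      have := hl (D g) (subset_closure (subset_convexHull ℝ _ (mem_range_self g)))
      change 0 ≤ H g - u * 1
      rw [hHapp]
      linarith
    rw [map_sub, map_smul, hone, hH, smul_eq_mul] at hge
    linarith
  obtain ⟨v, hv, hvδ⟩ := Metric.mem_closure_iff.1 h0 δ hδ
  rw [dist_zero_left] at hvδ
  obtain ⟨ι, _, w, z, hw, hw1, hz, rfl⟩ := mem_convexHull_iff_exists_fintype.1 hv
  choose x hx using hz
  let f : Γ → ℝ≥0 := fun g => ∑ i, if x i = g then (w i).toNNReal else 0
  have hf : ∀ g, (f g : ℝ) = ∑ i, if x i = g then w i else 0 := fun g => by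
    simp only [f, NNReal.coe_sum]
    refine Finset.sum_congr rfl fun i _ => ?_
    split_ifs <;> simp [hw i]
  refine ⟨Finset.univ.image x, f, fun g hg => ?_, ?_, ?_⟩
  · refine Finset.sum_eq_zero fun i _ => if_neg ?_
    rintro rfl
    exact hg (Finset.mem_image_of_mem _ (Finset.mem_univ i))
  · rw [← NNReal.coe_inj, NNReal.coe_sum]
    simp only [hf]
    rw [Finset.sum_comm, NNReal.coe_one, ← hw1]
    exact Finset.sum_congr rfl fun i _ => by simp
  · have key : ∀ s ∈ L, ∀ g,
        (∑ i, w i • z i : lp (fun _ : Γ × Γ => ℝ) 1) (s, g) = f g - f (s * g) := fun s hs g => by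
      have hD : ∀ y, D y (s, g) = (if y = g then 1 else 0) - (if y = s * g then 1 else 0) := by
        intro y
        have h1 : ∀ t y', (e (t, y') : Γ × Γ → ℝ) (s, g) =
            if t = s then (if y' = g then 1 else 0) else 0 := fun t y' => by
          simp only [e, lp.single_apply, Pi.single_apply, Prod.mk.injEq]
          grind
        simp only [D, lp.coeFn_sum, Finset.sum_apply, lp.coeFn_sub, Pi.sub_apply, h1]
        rw [Finset.sum_eq_single s (fun t _ ht => by simp [ht]) (fun h => (h hs).elim)]
        simp [inv_mul_eq_iff_eq_mul]
      simp only [lp.coeFn_sum, Finset.sum_apply, lp.coeFn_smul, Pi.smul_apply, ← hx, hD, hf,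
        smul_eq_mul, mul_sub, mul_ite, mul_one, mul_zero, Finset.sum_sub_distrib]
    have hsum := lp.sum_rpow_le_norm_rpow (p := 1) (by simp)
      (∑ i, w i • z i : lp (fun _ : Γ × Γ => ℝ) 1) (L ×ˢ Finset.univ.image x)
    simp only [ENNReal.toReal_one, Real.rpow_one] at hsum
    rw [Finset.sum_product] at hsum
    refine le_trans (le_of_eq ?_) (hsum.trans hvδ.le)
    refine Finset.sum_congr rfl fun s hs => Finset.sum_congr rfl fun g _ => ?_
    rw [key s hs g, Real.norm_eq_abs]

/-- A discrete **coarea inequality**: if all superlevel sets of a nonnegative function satisfy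
an isoperimetric inequality, then the function satisfies a Sobolev inequality. -/
theorem mul_sum_le_sum_sub_of_isoperimetric {α ι : Type*} (S : Finset α) (I : Finset ι)
    (φ : α → ℝ≥0) (u v : ι → α) (c : ℝ≥0∞)
    (h : ∀ t : ℝ, 0 ≤ t → c * (S.filter fun x => t < φ x).card ≤
      (I.filter fun i => (φ (v i) : ℝ) ≤ t ∧ t < φ (u i)).card) :
    c * ∑ x ∈ S, (φ x : ℝ≥0∞) ≤ ∑ i ∈ I, ((φ (u i) - φ (v i) : ℝ≥0) : ℝ≥0∞) := by
  have hvol : ∀ a b : ℝ≥0, ∫⁻ t : ℝ, (Ico (b : ℝ) a).indicator 1 t = ((a - b : ℝ≥0) : ℝ≥0∞) := by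
    intro a b
    rw [lintegral_indicator_one measurableSet_Ico, Real.volume_Ico, ENNReal.ofReal,
      ← NNReal.sub_def]
  have hS : ∑ x ∈ S, (φ x : ℝ≥0∞) = ∫⁻ t : ℝ, ∑ x ∈ S, (Ico (0 : ℝ) (φ x)).indicator 1 t := by
    rw [lintegral_finsetSum _ fun x _ => measurable_one.indicator measurableSet_Ico]
    exact Finset.sum_congr rfl fun x _ => by simp
  have hI : ∑ i ∈ I, ((φ (u i) - φ (v i) : ℝ≥0) : ℝ≥0∞) =
      ∫⁻ t : ℝ, ∑ i ∈ I, (Ico (φ (v i) : ℝ) (φ (u i))).indicator 1 t := by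
    rw [lintegral_finsetSum _ fun x _ => measurable_one.indicator measurableSet_Ico]
    exact Finset.sum_congr rfl fun i _ => (hvol _ _).symm
  rw [hS, hI, ← lintegral_const_mul _ (Finset.measurable_fun_sum _ fun x _ =>
    measurable_one.indicator measurableSet_Ico)]
  refine lintegral_mono fun t => ?_
  rcases lt_or_ge t 0 with ht | ht
  · simp [Set.indicator, not_le.2 ht]
  · simpa [Set.indicator, ht, Finset.sum_ite] using h t ht

section FolnerTile

variable {Γ X : Type*} [Group Γ] [MulAction Γ X]

/-- `A • z` is a **Følner tile** inside `Y`: it is contained in `Y`, is parametrized injectively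
by `A`, and each `γ ∈ L` moves at most a proportion `ε` of it into the rest of `Y`. -/
def IsFolnerTile (L : Finset Γ) (ε : ℝ≥0∞) (Y : Set X) (A : Finset Γ) (z : X) : Prop :=
  (∀ a ∈ A, a • z ∈ Y) ∧ InjOn (fun a : Γ => a • z) A ∧
    ∀ γ ∈ L, ∑ a ∈ A, {x | γ • a • x ∈ Y ∧ ∀ b ∈ A, γ • a • x ≠ b • x}.indicator 1 z ≤ ε * A.card

theorem mul_sum_indicator_le_of_forall_not_isFolnerTile {L T : Finset Γ} {f : Γ → ℝ≥0}
    (hf : ∀ g ∉ T, f g = 0) {ε : ℝ≥0∞} {Y : Set X} {z : X}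
    (h : ∀ A ⊆ T, A.Nonempty → ¬ IsFolnerTile L ε Y A z) :
    ε * ∑ g ∈ T, {x | g • x ∈ Y}.indicator (fun _ => (f g : ℝ≥0∞)) z ≤
      ∑ s ∈ L, ∑ g ∈ T, ((f g - f (s * g) : ℝ≥0) : ℝ≥0∞) := by
  classical
  let φ : X → ℝ≥0 := fun x => ∑ g ∈ T with g • z = x, f g
  let O : Finset X := T.image (· • z)
  let S : Finset X := O.filter (· ∈ Y)
  let I : Finset (Γ × X) := (L ×ˢ S).filter fun i => i.1 • i.2 ∈ Y
  have hmass : ∑ g ∈ T, {x | g • x ∈ Y}.indicator (fun _ => (f g : ℝ≥0∞)) z =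
      ∑ x ∈ S, (φ x : ℝ≥0∞) := by
    have h1 : ∑ g ∈ T, {x | g • x ∈ Y}.indicator (fun _ => (f g : ℝ≥0∞)) z =
        ∑ x ∈ O, ∑ g ∈ T with g • z = x, {x | g • x ∈ Y}.indicator (fun _ => (f g : ℝ≥0∞)) z :=
      (Finset.sum_fiberwise_of_maps_to (fun g hg => Finset.mem_image_of_mem _ hg) _).symm
    rw [h1, Finset.sum_filter]
    refine Finset.sum_congr rfl fun x _ => ?_
    split_ifs with hx
    · rw [ENNReal.ofNNReal_finsetSum]
      refine Finset.sum_congr rfl fun g hg => ?_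
      rw [Finset.mem_filter] at hg
      rw [Set.indicator_of_mem]
      simpa [hg.2] using hx
    · refine Finset.sum_eq_zero fun g hg => ?_
      rw [Finset.mem_filter] at hg
      rw [Set.indicator_of_notMem]
      simpa [hg.2] using hx
  have hdiff : ∀ s x, φ x - φ (s • x) ≤ ∑ g ∈ T with g • z = x, (f g - f (s * g)) := by
    intro s x
    have h1 : ∑ g ∈ T with g • z = x, f (s * g) ≤ φ (s • x) := by
      rw [← Finset.sum_filter_of_ne (p := fun g => s * g ∈ T)
        (fun g _ hg => by by_contra hc; exact hg (hf _ hc)),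
        ← Finset.sum_image (f := f) (g := fun g => s * g) (fun a _ b _ hab => mul_left_cancel hab)]
      refine Finset.sum_le_sum_of_subset fun g hg => ?_
      obtain ⟨a, ha, rfl⟩ := Finset.mem_image.1 hg
      simp only [Finset.mem_filter] at ha ⊢
      exact ⟨ha.2, by rw [mul_smul, ha.1.2]⟩
    rw [tsub_le_iff_right]
    calc φ x ≤ ∑ g ∈ T with g • z = x, ((f g - f (s * g)) + f (s * g)) :=
          Finset.sum_le_sum fun g _ => le_tsub_add
      _ ≤ _ := by rw [Finset.sum_add_distrib]; gcongr
  have hcoarea := mul_sum_le_sum_sub_of_isoperimetric S I φ (fun i => i.2) (fun i => i.1 • i.2) ε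
    (fun t ht => by
      obtain ⟨A, hAT, hinj, hA⟩ := Finset.exists_subset_injOn_image_eq_of_surjOn
        (f := (· • z)) (T : Set Γ)
        (S.filter fun x => t < φ x) (fun x hx => by
          have : x ∈ O := (Finset.mem_filter.1 (Finset.mem_filter.1 hx).1).1
          simpa [O, Set.mem_image] using this)
      have hmem : ∀ a ∈ A, a • z ∈ S ∧ t < φ (a • z) := fun a ha =>
        Finset.mem_filter.1 (hA ▸ Finset.mem_image_of_mem _ ha)
      rw [← hA, Finset.card_image_of_injOn hinj]
      rcases A.eq_empty_or_nonempty with rfl | hne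
      · simp
      have hnot := h A hAT hne
      simp only [IsFolnerTile, not_and, not_forall, not_le] at hnot
      obtain ⟨γ, hγ, hlt⟩ := hnot (fun a ha => (Finset.mem_filter.1 (hmem a ha).1).2) hinj
      refine hlt.le.trans ?_
      simp only [Set.indicator_apply, mem_ofPred_eq, Pi.one_apply, Finset.sum_boole]
      rw [Nat.cast_le]
      refine Finset.card_le_card_of_injOn (fun a => (γ, a • z)) (fun a ha => ?_)
        (fun a ha b hb hab => hinj (Finset.mem_filter.1 ha).1 (Finset.mem_filter.1 hb).1
          (Prod.mk.inj hab).2)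
      obtain ⟨haA, haY, hne'⟩ := Finset.mem_filter.1 ha
      refine Finset.mem_filter.2 ⟨Finset.mem_filter.2 ⟨Finset.mem_product.2
        ⟨hγ, (hmem a haA).1⟩, haY⟩, ?_, (hmem a haA).2⟩
      by_contra hlt'
      rw [not_le] at hlt'
      have hO : γ • a • z ∈ O := by
        by_contra hO
        have : φ (γ • a • z) = 0 := by
          refine Finset.sum_eq_zero fun g hg => (hO ?_).elim
          rw [Finset.mem_filter] at hg
          exact Finset.mem_image.2 ⟨g, hg⟩
        simp only [this, NNReal.coe_zero] at hlt'
        exact ht.not_gt hlt'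
      have : γ • a • z ∈ A.image (· • z) := by
        rw [hA]
        exact Finset.mem_filter.2 ⟨Finset.mem_filter.2 ⟨hO, haY⟩, hlt'⟩
      obtain ⟨b, hb, hb'⟩ := Finset.mem_image.1 this
      exact hne' b hb hb'.symm)
  rw [hmass]
  refine hcoarea.trans ?_
  calc ∑ i ∈ I, ((φ i.2 - φ (i.1 • i.2) : ℝ≥0) : ℝ≥0∞)
      ≤ ∑ i ∈ L ×ˢ O, ((φ i.2 - φ (i.1 • i.2) : ℝ≥0) : ℝ≥0∞) :=
        Finset.sum_le_sum_of_subset ((Finset.filter_subset _ _).trans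
          (Finset.product_subset_product_right (Finset.filter_subset _ _)))
    _ = ∑ s ∈ L, ∑ x ∈ O, ((φ x - φ (s • x) : ℝ≥0) : ℝ≥0∞) := Finset.sum_product _ _ _
    _ ≤ ∑ s ∈ L, ∑ x ∈ O, ∑ g ∈ T with g • z = x, ((f g - f (s * g) : ℝ≥0) : ℝ≥0∞) := by
        gcongr with s _ x _
        rw [← ENNReal.ofNNReal_finsetSum]
        exact ENNReal.coe_le_coe.2 (hdiff s x)
    _ = _ := Finset.sum_congr rfl fun s _ =>
        Finset.sum_fiberwise_of_maps_to (fun g hg => Finset.mem_image_of_mem _ hg) _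

variable [MeasurableSpace X] [MeasurableConstSMul Γ X]

theorem measurableSet_smul_eq_smul [MeasurableEq X] (g h : Γ) :
    MeasurableSet {x : X | g • x = h • x} :=
  measurableSet_eq_fun (measurable_const_smul g) (measurable_const_smul h)

theorem measurableSet_escape [MeasurableEq X] {Y : Set X} (hY : MeasurableSet Y) (A : Finset Γ)
    (γ a : Γ) : MeasurableSet {x : X | γ • a • x ∈ Y ∧ ∀ b ∈ A, γ • a • x ≠ b • x} := by
  have h1 : ∀ b : Γ, MeasurableSet {x : X | γ • a • x = b • x} := fun b => by
    simpa only [mul_smul] using measurableSet_smul_eq_smul (γ * a) b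
  have : {x : X | γ • a • x ∈ Y ∧ ∀ b ∈ A, γ • a • x ≠ b • x} =
      (fun x => γ • a • x) ⁻¹' Y ∩ ⋂ b ∈ A, {x : X | γ • a • x = b • x}ᶜ := by
    ext x; simp
  rw [this]
  exact ((measurable_const_smul γ).comp (measurable_const_smul a) hY).inter
    (Finset.measurableSet_biInter A fun b _ => (h1 b).compl)

theorem measurableSet_isFolnerTile [MeasurableEq X] (L : Finset Γ) (ε : ℝ≥0∞)
    {Y : Set X} (hY : MeasurableSet Y) (A : Finset Γ) :
    MeasurableSet {z : X | IsFolnerTile L ε Y A z} := by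
  have : {z : X | IsFolnerTile L ε Y A z} = (⋂ a ∈ A, (a • ·) ⁻¹' Y) ∩
      ((⋂ a ∈ A, ⋂ b ∈ A, {z : X | a • z = b • z → a = b}) ∩
        ⋂ γ ∈ L, {z | ∑ a ∈ A, {x | γ • a • x ∈ Y ∧ ∀ b ∈ A, γ • a • x ≠ b • x}.indicator 1 z ≤
          ε * A.card}) := by
    ext z; simp [IsFolnerTile, InjOn]
  rw [this]
  refine MeasurableSet.inter ?_ (MeasurableSet.inter ?_ ?_)
  · exact Finset.measurableSet_biInter A fun a _ => measurable_const_smul a hY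
  · refine Finset.measurableSet_biInter A fun a _ => Finset.measurableSet_biInter A fun b _ => ?_
    by_cases hab : a = b
    · simp [hab]
    · have : {z : X | a • z = b • z → a = b} = {z : X | a • z = b • z}ᶜ := by ext; simp [hab]
      rw [this]
      exact (measurableSet_smul_eq_smul a b).compl
  · refine Finset.measurableSet_biInter L fun γ _ => measurableSet_le ?_ measurable_const
    exact Finset.measurable_fun_sum _ fun a _ =>
      measurable_one.indicator (measurableSet_escape hY A γ a)

theorem measure_le_measure_isFolnerTile_add [MeasurableEq X] {μ : Measure X}
    [IsProbabilityMeasure μ] [SMulInvariantMeasure Γ X μ]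
    {L T : Finset Γ} {f : Γ → ℝ≥0} (hf : ∀ g ∉ T, f g = 0) (hf1 : ∑ g ∈ T, f g = 1)
    {ε : ℝ≥0∞} (hε0 : ε ≠ 0) (hε : ε ≠ ∞) {η : ℝ≥0∞}
    (hfη : ∑ s ∈ L, ∑ g ∈ T, ((f g - f (s * g) : ℝ≥0) : ℝ≥0∞) ≤ ε * η)
    {Y : Set X} (hY : MeasurableSet Y) :
    μ Y ≤ μ (⋃ A ∈ T.powerset.filter Finset.Nonempty, {z | IsFolnerTile L ε Y A z}) + η := by
  have hmeas : ∀ g : Γ, MeasurableSet {x : X | g • x ∈ Y} := fun g => measurable_const_smul g hY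
  set G := ⋃ A ∈ T.powerset.filter Finset.Nonempty, {z : X | IsFolnerTile L ε Y A z} with hG
  have hGm : MeasurableSet G :=
    Finset.measurableSet_biUnion _ fun A _ => measurableSet_isFolnerTile L ε hY A
  calc μ Y = ∑ g ∈ T, (f g : ℝ≥0∞) * μ Y := by
        rw [← Finset.sum_mul, ← ENNReal.ofNNReal_finsetSum, hf1, ENNReal.coe_one, one_mul]
    _ = ∫⁻ z, ∑ g ∈ T, {x | g • x ∈ Y}.indicator (fun _ => (f g : ℝ≥0∞)) z ∂μ := by
        rw [lintegral_finsetSum _ fun g _ => measurable_const.indicator (hmeas g)]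
        refine Finset.sum_congr rfl fun g _ => ?_
        rw [lintegral_indicator_const (hmeas g)]
        congr 1
        exact (measure_preimage_smul μ g Y).symm
    _ ≤ ∫⁻ z, (G.indicator 1 z + η) ∂μ := by
        refine lintegral_mono fun z => ?_
        by_cases hz : z ∈ G
        · rw [Set.indicator_of_mem hz, Pi.one_apply]
          refine le_trans ?_ le_self_add
          calc ∑ g ∈ T, {x | g • x ∈ Y}.indicator (fun _ => (f g : ℝ≥0∞)) z
              ≤ ∑ g ∈ T, (f g : ℝ≥0∞) := Finset.sum_le_sum fun g _ =>
                Set.indicator_apply_le' (fun _ => le_rfl) (fun _ => zero_le)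
            _ = 1 := by rw [← ENNReal.ofNNReal_finsetSum, hf1, ENNReal.coe_one]
        · refine le_trans ?_ le_add_self
          rw [← ENNReal.mul_le_mul_iff_right hε0 hε]
          refine (mul_sum_indicator_le_of_forall_not_isFolnerTile hf fun A hA hne hAz => hz ?_).trans
            hfη
          exact mem_biUnion (Finset.mem_filter.2 ⟨Finset.mem_powerset.2 hA, hne⟩) hAz
    _ = μ G + η := by
        rw [lintegral_add_right _ measurable_const, lintegral_indicator_one hGm]
        simp

end FolnerTile

section PartialTiling

variable {Γ X : Type*} [Group Γ] [MulAction Γ X] [MeasurableSpace X]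

theorem exists_cover_forall_smul_mem_imp_eq [StandardBorelSpace X] [MeasurableConstSMul Γ X]
    (Q : Finset Γ) :
    ∃ B : ℕ → Set X, (∀ n, MeasurableSet (B n)) ∧ ⋃ n, B n = univ ∧
      ∀ n, ∀ g ∈ Q, ∀ z ∈ B n, g • z ∈ B n → g • z = z := by
  obtain ⟨e, he⟩ := exists_surjective_nat (ℚ × ℚ)
  let r : X → ℝ := embeddingReal X
  have hr : MeasurableEmbedding r := measurableEmbedding_embeddingReal X
  let J : ℕ → Set ℝ := fun n => Ioo ((e n).1 : ℝ) (e n).2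
  let B : ℕ → Set X := fun n =>
    r ⁻¹' J n ∩ ⋂ g ∈ Q, ({z | g • z = (1 : Γ) • z} ∪ {z | r (g • z) ∈ J n}ᶜ)
  refine ⟨B, fun n => ?_, ?_, fun n g hg z hz hgz => ?_⟩
  · refine (hr.measurable measurableSet_Ioo).inter (Finset.measurableSet_biInter Q fun g _ => ?_)
    exact (measurableSet_smul_eq_smul g 1).union
      ((hr.measurable.comp (measurable_const_smul g)) measurableSet_Ioo).compl
  · refine eq_univ_of_forall fun z => mem_iUnion.2 ?_
    let P : Set ℝ := (fun g : Γ => r (g • z)) '' {g ∈ Q | g • z ≠ z}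
    have hP : P.Finite := (Q.finite_toSet.subset fun g hg => hg.1).image _
    have hzP : r z ∈ Pᶜ := by
      rintro ⟨g, hg, hgz⟩
      exact hg.2 (hr.injective hgz)
    obtain ⟨V, hV, hzV, hVP⟩ := Real.isTopologicalBasis_Ioo_rat.mem_nhds_iff.1
      (hP.isClosed.isOpen_compl.mem_nhds hzP)
    simp only [mem_iUnion, mem_singleton_iff] at hV
    obtain ⟨p, q, -, rfl⟩ := hV
    obtain ⟨n, hn⟩ := he (p, q)
    have hJ : J n = Ioo (p : ℝ) q := by simp [J, hn]
    refine ⟨n, by rw [mem_preimage, hJ]; exact hzV, mem_iInter₂.2 fun g hg => ?_⟩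
    by_cases hgz : g • z = z
    · exact Or.inl (by simpa using hgz)
    · refine Or.inr fun hmem => hVP (a := r (g • z)) ?_ ⟨g, ⟨hg, hgz⟩, rfl⟩
      rwa [← hJ]
  · rcases mem_iInter₂.1 hz.2 g hg with h | h
    · simpa using h
    · exact (h hgz.1).elim

/-- `F` is a Borel equivalence relation with finite classes, contained in the orbit relation and
trivial on `Y`, which separates few points of the complement of `Y` from their `L`-neighbours. -/
structure IsPartialTiling (μ : Measure X) (L : Finset Γ) (ε : ℝ≥0∞) (Y : Set X)
    (F : X → X → Prop) : Prop where
  equivalence : Equivalence F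
  measurableSet_rel : MeasurableSet {p : X × X | F p.1 p.2}
  finite_classes : ∀ x, {y | F x y}.Finite
  exists_smul_eq : ∀ x y, F x y → ∃ g : Γ, g • x = y
  measurableSet_rest : MeasurableSet Y
  eq_of_mem : ∀ x y, F x y → x ∈ Y → x = y
  measure_cut_le : ∀ γ ∈ L, μ {x | ¬ F x (γ • x) ∧ ¬ (x ∈ Y ∧ γ • x ∈ Y)} ≤ ε * μ Yᶜ

theorem isPartialTiling_univ_eq [MeasurableEq X] (μ : Measure X) (L : Finset Γ) (ε : ℝ≥0∞) :
    IsPartialTiling μ L ε univ (fun x y : X => x = y) where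
  equivalence := eq_equivalence
  measurableSet_rel := measurableSet_eq_fun measurable_fst measurable_snd
  finite_classes x := by simp
  exists_smul_eq x y h := ⟨1, by simpa using h⟩
  measurableSet_rest := MeasurableSet.univ
  eq_of_mem _ _ h _ := h
  measure_cut_le := by simp

theorem IsPartialTiling.exists_extension [MeasurableEq X] [MeasurableConstSMul Γ X]
    {μ : Measure X} [IsProbabilityMeasure μ] [SMulInvariantMeasure Γ X μ]
    {L : Finset Γ} (hL : ∀ γ ∈ L, γ⁻¹ ∈ L) {ε : ℝ≥0∞} {Y : Set X} {F : X → X → Prop}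
    (hF : IsPartialTiling μ L (2 * ε) Y F) {A : Finset Γ} (hA : A.Nonempty)
    {B : Set X} (hB : MeasurableSet B) (hBtile : ∀ z ∈ B, IsFolnerTile L ε Y A z)
    (hBsep : ∀ a ∈ A, ∀ b ∈ A, ∀ z ∈ B, (a⁻¹ * b) • z ∈ B → (a⁻¹ * b) • z = z) :
    ∃ Y' F', IsPartialTiling μ L (2 * ε) Y' F' ∧ μ Y' + μ B ≤ μ Y := by
  have hpre : ∀ a : Γ, MeasurableSet {x : X | a⁻¹ • x ∈ B} := fun a =>
    measurable_const_smul a⁻¹ hB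
  have hbase : ∀ x, ∀ a ∈ A, ∀ b ∈ A, a⁻¹ • x ∈ B → b⁻¹ • x ∈ B → a⁻¹ • x = b⁻¹ • x := by
    intro x a ha b hb hax hbx
    have h := hBsep a ha b hb (b⁻¹ • x) hbx
    rw [mul_smul, smul_inv_smul] at h
    exact h hax
  set Z : Set X := ⋃ a ∈ A, {x | a⁻¹ • x ∈ B} with hZ
  have memZ : ∀ x, x ∈ Z ↔ ∃ a ∈ A, a⁻¹ • x ∈ B := fun x => by simp [hZ]
  have hZm : MeasurableSet Z := Finset.measurableSet_biUnion A fun a _ => hpre a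
  have hZY : Z ⊆ Y := by
    intro x hx
    obtain ⟨a, ha, hax⟩ := (memZ x).1 hx
    simpa using (hBtile _ hax).1 a ha
  have hμpre : ∀ a : Γ, μ {x | a⁻¹ • x ∈ B} = μ B := fun a => measure_preimage_smul μ a⁻¹ B
  have hμZ : μ Z = A.card * μ B := by
    rw [hZ, measure_biUnion_finset ?_ fun a _ => hpre a]
    · simp [hμpre]
    · intro a ha b hb hab
      refine Set.disjoint_left.2 fun x hax hbx => hab ((hBtile _ hax).2.1 ha hb ?_)
      simp only [smul_inv_smul]
      rw [hbase x a ha b hb hax hbx, smul_inv_smul]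
  let esc : Γ → Γ → Set X := fun γ a => {x | γ • a • x ∈ Y ∧ ∀ b ∈ A, γ • a • x ≠ b • x}
  have hesc : ∀ γ a, MeasurableSet (esc γ a) := fun γ a =>
    measurableSet_escape hF.measurableSet_rest A γ a
  let E : Γ → Set X := fun γ => ⋃ a ∈ A, (a⁻¹ • ·) ⁻¹' (B ∩ esc γ a)
  have hμE : ∀ γ ∈ L, μ (E γ) ≤ ε * μ Z := by
    intro γ hγ
    calc μ (E γ) ≤ ∑ a ∈ A, μ ((a⁻¹ • ·) ⁻¹' (B ∩ esc γ a)) := measure_biUnion_finset_le _ _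
      _ = ∑ a ∈ A, ∫⁻ z in B, (esc γ a).indicator 1 z ∂μ := by
          refine Finset.sum_congr rfl fun a _ => ?_
          rw [measure_preimage_smul, lintegral_indicator_one (hesc γ a),
            Measure.restrict_apply (hesc γ a), Set.inter_comm]
      _ = ∫⁻ z in B, ∑ a ∈ A, (esc γ a).indicator 1 z ∂μ :=
          (lintegral_finsetSum _ fun a _ => measurable_one.indicator (hesc γ a)).symm
      _ ≤ ∫⁻ z in B, ε * A.card ∂μ :=
          setLIntegral_mono measurable_const fun z hz => (hBtile z hz).2.2 γ hγ
      _ = ε * μ Z := by rw [setLIntegral_const, hμZ, mul_assoc]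
  let N : X → X → Prop := fun x y => ∃ a ∈ A, ∃ b ∈ A, a⁻¹ • x ∈ B ∧ y = b • a⁻¹ • x
  have hNZ : ∀ x y, N x y → x ∈ Z ∧ y ∈ Z := by
    rintro x y ⟨a, ha, b, hb, hx, rfl⟩
    exact ⟨(memZ _).2 ⟨a, ha, hx⟩, (memZ _).2 ⟨b, hb, by simpa using hx⟩⟩
  have hNsymm : ∀ x y, N x y → N y x := by
    rintro x y ⟨a, ha, b, hb, hx, rfl⟩
    exact ⟨b, hb, a, ha, by simpa using hx, by simp⟩
  have hFZ : ∀ x y, F x y → (x ∈ Z ∨ y ∈ Z) → x = y := by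
    rintro x y h (hx | hy)
    · exact hF.eq_of_mem x y h (hZY hx)
    · exact (hF.eq_of_mem y x (hF.equivalence.symm h) (hZY hy)).symm
  refine ⟨Y \ Z, fun x y => F x y ∨ N x y, ⟨⟨fun x => Or.inl (hF.equivalence.refl x),
    fun h => h.imp hF.equivalence.symm (hNsymm _ _), ?_⟩, ?_, fun x => ?_, ?_,
    hF.measurableSet_rest.diff hZm, ?_, ?_⟩, ?_⟩
  · rintro x y z (h1 | h1) (h2 | h2)
    · exact Or.inl (hF.equivalence.trans h1 h2)
    · obtain rfl := hFZ x y h1 (Or.inr (hNZ _ _ h2).1)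
      exact Or.inr h2
    · obtain rfl := hFZ y z h2 (Or.inl (hNZ _ _ h1).2)
      exact Or.inr h1
    · obtain ⟨a, ha, b, hb, hx, rfl⟩ := h1
      obtain ⟨c, hc, d, hd, hy, rfl⟩ := h2
      refine Or.inr ⟨a, ha, d, hd, hx, ?_⟩
      rw [hbase _ c hc b hb hy (by simpa using hx), inv_smul_smul]
  · have : {p : X × X | F p.1 p.2 ∨ N p.1 p.2} = {p : X × X | F p.1 p.2} ∪
        ⋃ a ∈ A, ⋃ b ∈ A, (Prod.fst ⁻¹' {x | a⁻¹ • x ∈ B} ∩ {p : X × X | p.2 = b • a⁻¹ • p.1}) := by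
      ext p; simp [N]; grind
    rw [this]
    refine hF.measurableSet_rel.union (Finset.measurableSet_biUnion A fun a _ =>
      Finset.measurableSet_biUnion A fun b _ => (measurable_fst (hpre a)).inter
        (measurableSet_eq_fun measurable_snd ?_))
    exact (measurable_const_smul b).comp ((measurable_const_smul a⁻¹).comp measurable_fst)
  · classical
    refine ((hF.finite_classes x).union
      ((A ×ˢ A).image fun p => p.2 • p.1⁻¹ • x).finite_toSet).subset ?_
    rintro y (hy | ⟨a, ha, b, hb, -, rfl⟩)
    · exact Or.inl hy
    · exact Or.inr (Finset.mem_coe.2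
        (Finset.mem_image.2 ⟨(a, b), Finset.mem_product.2 ⟨ha, hb⟩, rfl⟩))
  · rintro x y (h | ⟨a, ha, b, hb, hx, rfl⟩)
    · exact hF.exists_smul_eq x y h
    · exact ⟨b * a⁻¹, mul_smul _ _ _⟩
  · rintro x y (h | h) hx
    · exact hF.eq_of_mem x y h hx.1
    · exact (hx.2 (hNZ x y h).1).elim
  · intro γ hγ
    have hsub : {x | ¬ (F x (γ • x) ∨ N x (γ • x)) ∧ ¬ (x ∈ Y \ Z ∧ γ • x ∈ Y \ Z)} ⊆
        {x | ¬ F x (γ • x) ∧ ¬ (x ∈ Y ∧ γ • x ∈ Y)} ∪ (E γ ∪ (γ • ·) ⁻¹' E γ⁻¹) := by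
      rintro x ⟨h1, h2⟩
      rw [not_or] at h1
      by_cases hY : x ∈ Y ∧ γ • x ∈ Y
      · right
        by_cases hxZ : x ∈ Z
        · left
          obtain ⟨a, ha, hax⟩ := (memZ x).1 hxZ
          refine mem_biUnion ha ⟨hax, by simpa using hY.2, fun b hb heq => ?_⟩
          exact h1.2 ⟨a, ha, b, hb, hax, by simpa using heq⟩
        · have hγZ : γ • x ∈ Z := by
            by_contra hγZ
            exact h2 ⟨⟨hY.1, hxZ⟩, hY.2, hγZ⟩
          right
          obtain ⟨a, ha, hax⟩ := (memZ _).1 hγZ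
          refine mem_biUnion ha ⟨hax, by simpa using hY.1, fun b hb heq => ?_⟩
          exact h1.2 (hNsymm _ _ ⟨a, ha, b, hb, hax, by simpa using heq⟩)
      · exact Or.inl ⟨h1.1, hY⟩
    have hcompl : μ (Y \ Z)ᶜ = μ Yᶜ + μ Z := by
      rw [Set.compl_sdiff, Set.union_comm, measure_union _ hZm]
      exact Set.disjoint_left.2 fun x hx hxZ => hx (hZY hxZ)
    calc _ ≤ μ {x | ¬ F x (γ • x) ∧ ¬ (x ∈ Y ∧ γ • x ∈ Y)} + (μ (E γ) + μ ((γ • ·) ⁻¹' E γ⁻¹)) :=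
          (measure_mono hsub).trans ((measure_union_le _ _).trans
            (add_le_add_right (measure_union_le _ _) _))
      _ ≤ 2 * ε * μ Yᶜ + (ε * μ Z + ε * μ Z) := by
          rw [measure_preimage_smul]
          gcongr
          exacts [hF.measure_cut_le γ hγ, hμE γ hγ, hμE _ (hL γ hγ)]
      _ = _ := by rw [hcompl]; ring
  · have hBZ : μ B ≤ μ Z := by
      rw [hμZ]
      exact le_mul_of_one_le_left' (by exact_mod_cast hA.card_pos)
    calc μ (Y \ Z) + μ B ≤ μ (Y \ Z) + μ Z := by gcongr
      _ = μ Y := by rw [← measure_union disjoint_sdiff_left hZm, sdiff_union_of_subset hZY]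

theorem exists_forall_isPartialTiling_exists_extension [StandardBorelSpace X]
    [MeasurableConstSMul Γ X] {μ : Measure X} [IsProbabilityMeasure μ] [SMulInvariantMeasure Γ X μ]
    (hΓ : IsAmenable Γ) {L : Finset Γ} (hL : ∀ γ ∈ L, γ⁻¹ ∈ L) {ε η : ℝ≥0}
    (hε : ε ≠ 0) (hη : η ≠ 0) :
    ∃ c : ℝ≥0∞, c ≠ 0 ∧ ∀ Y F, IsPartialTiling μ L (2 * ε) Y F → η ≤ μ Y →
      ∃ Y' F', IsPartialTiling μ L (2 * ε) Y' F' ∧ μ Y' + c ≤ μ Y := by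
  classical
  obtain ⟨T, f, hf, hf1, hfδ⟩ := hΓ.exists_reiter L (δ := (ε * (η / 4) : ℝ≥0))
    (by positivity)
  have hfη : ∑ s ∈ L, ∑ g ∈ T, ((f g - f (s * g) : ℝ≥0) : ℝ≥0∞) ≤ ε * (η / 4 : ℝ≥0) := by
    simp only [← ENNReal.ofNNReal_finsetSum]
    rw [← ENNReal.coe_mul, ENNReal.coe_le_coe, ← NNReal.coe_le_coe]
    refine le_trans ?_ hfδ
    simp only [NNReal.coe_sum]
    gcongr with s _ g _
    rw [NNReal.coe_sub_def]
    exact max_le (le_abs_self _) (abs_nonneg _)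
  obtain ⟨B, hB, hBcover, hBsep⟩ := exists_cover_forall_smul_mem_imp_eq (X := X)
    ((T ×ˢ T).image fun p => p.1⁻¹ * p.2)
  obtain ⟨n, hn⟩ : ∃ n, μ (accumulate B n)ᶜ ≤ (η / 4 : ℝ≥0) := by
    have hlim := tendsto_measure_iUnion_accumulate (μ := μ) (f := B)
    rw [hBcover, measure_univ] at hlim
    have hlt : 1 - ((η / 4 : ℝ≥0) : ℝ≥0∞) < 1 :=
      ENNReal.sub_lt_self one_ne_top one_ne_zero (by simpa using hη)
    obtain ⟨n, hn⟩ := (hlim.eventually (lt_mem_nhds hlt)).exists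
    refine ⟨n, ?_⟩
    have hacc : MeasurableSet (accumulate B n) :=
      MeasurableSet.biUnion (to_countable _) fun m _ => hB m
    rw [prob_compl_eq_one_sub hacc, tsub_le_iff_right, add_comm]
    exact tsub_le_iff_right.1 hn.le
  let P : Finset (Finset Γ × ℕ) := T.powerset.filter Finset.Nonempty ×ˢ Finset.range (n + 1)
  refine ⟨(η / 4 : ℝ≥0) / P.card, ?_, fun Y F hF hY => ?_⟩
  · exact ENNReal.div_ne_zero.2 ⟨by simpa using hη, by simp⟩
  have hYm := hF.measurableSet_rest
  obtain ⟨i, hi, hci⟩ : ∃ i ∈ P, (η / 4 : ℝ≥0) / (P.card : ℝ≥0∞) ≤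
      μ (B i.2 ∩ {z | IsFolnerTile L ε Y i.1 z}) := by
    by_contra! hcon
    have hsub : (⋃ A ∈ T.powerset.filter Finset.Nonempty, {z | IsFolnerTile L ε Y A z}) ⊆
        (⋃ i ∈ P, B i.2 ∩ {z | IsFolnerTile L ε Y i.1 z}) ∪ (accumulate B n)ᶜ := by
      intro z hz
      by_cases hzn : z ∈ accumulate B n
      · obtain ⟨A, hA, hAz⟩ := mem_iUnion₂.1 hz
        obtain ⟨m, hm, hmz⟩ := mem_accumulate.1 hzn
        exact Or.inl (mem_biUnion (x := (A, m)) (Finset.mem_coe.2 (Finset.mem_product.2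
          ⟨hA, Finset.mem_range.2 (Nat.lt_succ_of_le hm)⟩)) ⟨hmz, hAz⟩)
      · exact Or.inr hzn
    have hle : (η : ℝ≥0∞) ≤ ((η / 4 : ℝ≥0) : ℝ≥0∞) + (η / 4 : ℝ≥0) + (η / 4 : ℝ≥0) := by
      calc (η : ℝ≥0∞) ≤ μ Y := hY
        _ ≤ _ := measure_le_measure_isFolnerTile_add hf hf1 (by simpa using hε) coe_ne_top hfη hYm
        _ ≤ _ := by
          gcongr
          refine (measure_mono hsub).trans ((measure_union_le _ _).trans (add_le_add ?_ hn))
          calc _ ≤ ∑ i ∈ P, μ (B i.2 ∩ {z | IsFolnerTile L ε Y i.1 z}) :=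
                measure_biUnion_finset_le _ _
            _ ≤ ∑ i ∈ P, (η / 4 : ℝ≥0) / (P.card : ℝ≥0∞) :=
                Finset.sum_le_sum fun i hi => (hcon i hi).le
            _ ≤ _ := by
                rw [Finset.sum_const, nsmul_eq_mul]
                exact ENNReal.mul_div_le
    have hle' : (η : ℝ) ≤ η / 4 + η / 4 + η / 4 := by exact_mod_cast hle
    have : (0 : ℝ) < η := by positivity
    linarith
  obtain ⟨hA, -⟩ := Finset.mem_product.1 hi
  obtain ⟨hAT, hAne⟩ := Finset.mem_filter.1 hA
  rw [Finset.mem_powerset] at hAT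
  obtain ⟨Y', F', hF', hY'⟩ := hF.exists_extension hL hAne
    ((hB i.2).inter (measurableSet_isFolnerTile L ε hYm i.1)) (fun z hz => hz.2)
    (fun a ha b hb z hz hz' => hBsep i.2 _ (Finset.mem_image_of_mem (fun p : Γ × Γ => p.1⁻¹ * p.2)
      (Finset.mem_product.2 ⟨hAT ha, hAT hb⟩ : (a, b) ∈ T ×ˢ T)) z hz.1 hz'.1)
  exact ⟨Y', F', hF', le_trans (by gcongr) hY'⟩

/-- The orbit relation of a p.m.p. action of an amenable group is approximated by Borel
subrelations with finite classes. -/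
theorem exists_isPartialTiling_measure_not_rel_le [StandardBorelSpace X]
    [MeasurableConstSMul Γ X] {μ : Measure X} [IsProbabilityMeasure μ] [SMulInvariantMeasure Γ X μ]
    (hΓ : IsAmenable Γ) (K : Finset Γ) {δ : ℝ≥0} (hδ : δ ≠ 0) :
    ∃ L ε Y F, IsPartialTiling (X := X) (Γ := Γ) μ L ε Y F ∧
      ∀ γ ∈ K, μ {x | ¬ F x (γ • x)} ≤ δ := by
  classical
  let L : Finset Γ := K ∪ K.image (·⁻¹)
  have hL : ∀ γ ∈ L, γ⁻¹ ∈ L := by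
    intro γ hγ
    simp only [L, Finset.mem_union, Finset.mem_image] at hγ ⊢
    rcases hγ with h | ⟨a, ha, rfl⟩
    · exact Or.inr ⟨γ, h, rfl⟩
    · exact Or.inl (by simpa using ha)
  obtain ⟨c, hc, hstep⟩ := exists_forall_isPartialTiling_exists_extension (X := X) (μ := μ) hΓ hL
    (ε := δ / 4) (η := δ / 2) (by positivity) (by positivity)
  obtain ⟨Y, F, hF, hY⟩ : ∃ Y F, IsPartialTiling μ L (2 * (δ / 4 : ℝ≥0)) Y F ∧
      μ Y < (δ / 2 : ℝ≥0) := by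
    by_contra! hcon
    have hiter : ∀ n : ℕ, ∃ Y F, IsPartialTiling μ L (2 * (δ / 4 : ℝ≥0)) Y F ∧ μ Y + n * c ≤ 1 := by
      intro n
      induction n with
      | zero => exact ⟨univ, _, isPartialTiling_univ_eq μ L _, by simp⟩
      | succ n ih =>
        obtain ⟨Y, F, hF, hY⟩ := ih
        obtain ⟨Y', F', hF', hY'⟩ := hstep Y F hF (hcon Y F hF)
        refine ⟨Y', F', hF', le_trans ?_ hY⟩
        calc μ Y' + (n + 1 : ℕ) * c = (μ Y' + c) + n * c := by push_cast; ring
          _ ≤ μ Y + n * c := by gcongr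
    obtain ⟨n, hn⟩ := ENNReal.exists_nat_mul_gt hc one_ne_top
    obtain ⟨Y, F, -, hY⟩ := hiter n
    exact (le_add_self.trans hY).not_gt hn
  refine ⟨L, _, Y, F, hF, fun γ hγ => ?_⟩
  have hsub : {x | ¬ F x (γ • x)} ⊆ {x | ¬ F x (γ • x) ∧ ¬ (x ∈ Y ∧ γ • x ∈ Y)} ∪ Y := by
    intro x hx
    by_cases hxY : x ∈ Y
    · exact Or.inr hxY
    · exact Or.inl ⟨hx, fun h => hxY h.1⟩
  calc μ {x | ¬ F x (γ • x)} ≤ 2 * (δ / 4 : ℝ≥0) * μ Yᶜ + μ Y :=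
        (measure_mono hsub).trans ((measure_union_le _ _).trans
          (add_le_add_left (hF.measure_cut_le γ (Finset.mem_union_left _ hγ)) _))
    _ ≤ 2 * (δ / 4 : ℝ≥0) * 1 + (δ / 2 : ℝ≥0) := by
        gcongr
        exact prob_le_one
    _ = δ := by
        rw [mul_one]
        norm_cast
        rw [← NNReal.coe_inj]
        push_cast
        ring

end PartialTiling

/-- **Ornstein–Weiss theorem.** Every p.m.p. action of a countable amenable group on a
standard probability space generates a hyperfinite orbit equivalence relation. -/
theorem isHyperfinite_of_amenable
    {Γ : Type} [Group Γ] [Countable Γ] (hΓ : IsAmenable Γ)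
    {X : Type} [MeasurableSpace X] [StandardBorelSpace X]
    {μ : Measure X} [IsProbabilityMeasure μ]
    (A : PMPAction Γ X μ) (R : PMPRel X μ)
    (hR : ∀ x y, R.rel x y ↔ ∃ γ : Γ, A.act γ x = y) :
    R.IsHyperfinite := by
  classical
  let _ : MulAction Γ X := { smul := A.act, one_smul := A.act_one, mul_smul := A.act_mul }
  have : MeasurableConstSMul Γ X := ⟨fun γ => (A.measurePreserving γ).measurable⟩
  have : SMulInvariantMeasure Γ X μ :=
    ⟨fun γ s hs => (A.measurePreserving γ).measure_preimage hs.nullMeasurableSet⟩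
  obtain ⟨e, he⟩ := exists_surjective_nat Γ
  have happrox : ∀ n : ℕ, _ := fun n => exists_isPartialTiling_measure_not_rel_le (X := X) (μ := μ)
    hΓ ((Finset.range (n + 1)).image e) (δ := (1 / 2) ^ n) (by positivity)
  choose L ε Y F hF hFμ using happrox
  have hae : ∀ᵐ x ∂μ, ∀ γ : Γ, ∃ n, ∀ m ≥ n, F m x (γ • x) := by
    rw [ae_all_iff]
    intro γ
    obtain ⟨k, rfl⟩ := he γ
    have hsum : ∑' n, μ {x | ¬ F (n + k) x (e k • x)} ≠ ∞ := by
      refine ne_top_of_le_ne_top (b := ∑' n : ℕ, (((1 / 2) ^ n : ℝ≥0) : ℝ≥0∞)) ?_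
        (ENNReal.tsum_le_tsum fun n => ?_)
      · exact ENNReal.tsum_coe_ne_top_iff_summable.2 (NNReal.summable_geometric (by
          rw [← NNReal.coe_lt_coe]; norm_num))
      · refine (hFμ (n + k) (e k) (Finset.mem_image_of_mem e (by simp))).trans ?_
        refine ENNReal.coe_le_coe.2 (pow_le_pow_of_le_one (by simp) ?_ (by omega))
        rw [← NNReal.coe_le_coe]; norm_num
    filter_upwards [ae_eventually_notMem hsum] with x hx
    obtain ⟨n, hn⟩ := eventually_atTop.1 hx
    refine ⟨n + k, fun m hm => ?_⟩
    have := hn (m - k) (by omega)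
    rw [Nat.sub_add_cancel (by omega)] at this
    simpa using this
  refine ⟨fun n x y => ∀ m ≥ n, F m x y, {x | ∀ γ : Γ, ∃ n, ∀ m ≥ n, F m x (γ • x)}, hae,
    fun n => ⟨fun x m _ => (hF m).equivalence.refl x,
      fun h m hm => (hF m).equivalence.symm (h m hm),
      fun h h' m hm => (hF m).equivalence.trans (h m hm) (h' m hm)⟩, fun n => ?_,
    fun n x => ((hF n).finite_classes x).subset fun y hy => hy n le_rfl,
    fun n x y h m hm => h m (by omega), fun n x y h => ?_, ?_⟩
  · have : {p : X × X | ∀ m ≥ n, F m p.1 p.2} = ⋂ m, ⋂ _ : m ≥ n, {p | F m p.1 p.2} := by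
      ext p; simp
    rw [this]
    exact MeasurableSet.iInter fun m => MeasurableSet.iInter fun _ => (hF m).measurableSet_rel
  · exact (hR x y).2 ((hF n).exists_smul_eq x y (h n le_rfl))
  · intro x hx y _ hxy
    obtain ⟨γ, rfl⟩ := (hR x y).1 hxy
    exact hx γ
end

section
/- If a countable group Γ admits an (essentially) free probability-measure-preserving action on a standard probability space whose orbit equivalence relation is hyperfinite, then Γ is amenable. -/
open MeasureTheory Filter Topology Set ENNReal BoundedContinuousFunction

/-- **Reiter's condition** implies amenability: a sequence of probability vectors on `Γ` which is
asymptotically invariant in `ℓ¹` yields an invariant mean. -/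
theorem isAmenable_of_reiter {Γ : Type*} [Group Γ] (P : ℕ → Γ → ℝ)
    (hP_nonneg : ∀ n γ, 0 ≤ P n γ) (hP_sum : ∀ n, HasSum (P n) 1)
    (hP_inv : ∀ g : Γ,
      Tendsto (fun n => ∑' γ, |P n (g⁻¹ * γ) - P n γ|) atTop (𝓝 0)) :
    IsAmenable Γ := by
  let _ : TopologicalSpace Γ := ⊥
  have _ : DiscreteTopology Γ := ⟨rfl⟩
  have le_norm (f : Γ →ᵇ ℝ) (γ : Γ) : |f γ| ≤ ‖f‖ := f.norm_coe_le_norm γ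
  have summable_mul {a : Γ → ℝ} (ha : Summable a) (ha_nonneg : ∀ γ, 0 ≤ a γ) (f : Γ →ᵇ ℝ) :
      Summable fun γ => a γ * f γ :=
    Summable.of_norm_bounded (ha.mul_right ‖f‖) fun γ => by
      rw [Real.norm_eq_abs, abs_mul, abs_of_nonneg (ha_nonneg γ)]
      exact mul_le_mul_of_nonneg_left (le_norm f γ) (ha_nonneg γ)
  have summable_P (n : ℕ) (f : Γ →ᵇ ℝ) : Summable fun γ => P n γ * f γ :=
    summable_mul (hP_sum n).summable (hP_nonneg n) f
  have mean_le (n : ℕ) (f : Γ →ᵇ ℝ) : |∑' γ, P n γ * f γ| ≤ ‖f‖ := by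
    have h := tsum_of_norm_bounded ((hP_sum n).mul_right ‖f‖) (f := fun γ => P n γ * f γ)
      fun γ => by
        rw [Real.norm_eq_abs, abs_mul, abs_of_nonneg (hP_nonneg n γ)]
        exact mul_le_mul_of_nonneg_left (le_norm f γ) (hP_nonneg n γ)
    simpa using h
  have exists_lim (f : Γ →ᵇ ℝ) :
      ∃ l, Tendsto (fun n => ∑' γ, P n γ * f γ) (hyperfilter ℕ) (𝓝 l) := by
    obtain ⟨l, -, hl⟩ := (isCompact_Icc (a := -‖f‖) (b := ‖f‖)).ultrafilter_le_nhds
      ((hyperfilter ℕ).map fun n => ∑' γ, P n γ * f γ)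
      (le_principal_iff.2 (Ultrafilter.mem_map.2
        (Eventually.of_forall fun n => abs_le.1 (mean_le n f))))
    exact ⟨l, hl⟩
  choose m hm using exists_lim
  refine ⟨⟨⟨m, fun f f' => ?_⟩, fun c f => ?_⟩, fun f hf => ?_, ?_, fun g f => ?_⟩
  · refine tendsto_nhds_unique (hm _) (((hm f).add (hm f')).congr fun n => ?_)
    rw [← (summable_P n f).tsum_add (summable_P n f')]
    simp [mul_add]
  · refine tendsto_nhds_unique (hm _) (((hm f).const_mul c).congr fun n => ?_)
    rw [← tsum_mul_left]
    simp [mul_left_comm]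
  · exact ge_of_tendsto' (hm f) fun n => tsum_nonneg fun γ => mul_nonneg (hP_nonneg n γ) (hf γ)
  · refine tendsto_nhds_unique (hm 1) (tendsto_const_nhds.congr fun n => ?_)
    simpa using (hP_sum n).tsum_eq.symm
  · refine tendsto_nhds_unique (hm _) ?_
    have summable_shift (n : ℕ) : Summable fun γ => P n (g⁻¹ * γ) :=
      (Equiv.mulLeft g⁻¹).summable_iff.2 (hP_sum n).summable
    have hdiff : Tendsto
        (fun n => (∑' γ, P n (g⁻¹ * γ) * f γ) - ∑' γ, P n γ * f γ) atTop (𝓝 0) := by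
      refine squeeze_zero_norm (fun n => ?_) (by simpa using (hP_inv g).mul_const ‖f‖)
      rw [← (summable_mul (summable_shift n) (fun γ => hP_nonneg n _) f).tsum_sub (summable_P n f)]
      refine tsum_of_norm_bounded
        (((summable_shift n).sub (hP_sum n).summable).abs.hasSum.mul_right ‖f‖) fun γ => ?_
      rw [← sub_mul, Real.norm_eq_abs, abs_mul]
      exact mul_le_mul_of_nonneg_left (le_norm f γ) (abs_nonneg _)
    have h := (hdiff.mono_left (Nat.hyperfilter_le_atTop)).add (hm f)
    rw [zero_add] at h
    refine h.congr fun n => ?_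
    rw [sub_add_cancel, ← (Equiv.mulLeft g).tsum_eq]
    simp

namespace PMPAction

variable {Γ : Type*} [Group Γ] {X : Type*} [MeasurableSpace X] {μ : Measure X}

/-- The probability vector on `Γ` which is uniform on the set of those `γ` for which `γ⁻¹ • x` is
`S`-related to `x`; it is the zero vector if that set is infinite. -/
noncomputable def classWeight (A : PMPAction Γ X μ) (S : X → X → Prop) (x : X) (γ : Γ) : ℝ≥0∞ :=
  {y | S y (A.act γ⁻¹ y)}.indicator 1 x / ∑' δ : Γ, {y | S y (A.act δ⁻¹ y)}.indicator 1 x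

variable (A : PMPAction Γ X μ) {S : X → X → Prop}

theorem measurableSet_rel_act (hS : MeasurableSet {p : X × X | S p.1 p.2}) (γ : Γ) :
    MeasurableSet {x | S x (A.act γ x)} :=
  (measurable_id.prodMk (A.measurePreserving γ).measurable) hS

theorem measurable_classWeight [Countable Γ] (hS : MeasurableSet {p : X × X | S p.1 p.2}) (γ : Γ) :
    Measurable fun x => A.classWeight S x γ := by
  have h (δ : Γ) : Measurable ({y | S y (A.act δ⁻¹ y)}.indicator (1 : X → ℝ≥0∞)) :=
    measurable_one.indicator (A.measurableSet_rel_act hS δ⁻¹)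
  exact (h γ).div (Measurable.tsum h)

theorem tsum_classWeight_le_one (x : X) : ∑' γ, A.classWeight S x γ ≤ 1 := by
  simp only [classWeight, div_eq_mul_inv]
  rw [ENNReal.tsum_mul_right]
  exact ENNReal.mul_inv_le_one _

theorem tsum_classWeight (hS : Equivalence S) {x : X} (hfin : {y | S x y}.Finite)
    (hx : ∀ γ, A.act γ x = x → γ = 1) : ∑' γ, A.classWeight S x γ = 1 := by
  simp only [classWeight, div_eq_mul_inv]
  rw [ENNReal.tsum_mul_right]
  refine ENNReal.mul_inv_cancel ?_ ?_
  · refine fun h => one_ne_zero (α := ℝ≥0∞) ?_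
    simpa [A.act_one, hS.refl x] using ENNReal.tsum_eq_zero.1 h 1
  · have hinj : Function.Injective fun γ : Γ => A.act γ⁻¹ x := fun γ δ h => by
      refine (mul_inv_eq_one.1 (hx (δ * γ⁻¹) ?_)).symm
      rw [A.act_mul, show A.act γ⁻¹ x = A.act δ⁻¹ x from h, ← A.act_mul, mul_inv_cancel, A.act_one]
    have hD : {γ : Γ | S x (A.act γ⁻¹ x)}.Finite := hfin.preimage hinj.injOn
    rw [tsum_eq_sum (s := hD.toFinset) fun γ hγ => by simpa using hγ]
    exact ENNReal.sum_ne_top.2 fun γ _ =>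
      ne_top_of_le_ne_top one_ne_top (indicator_le_self' (fun _ _ => zero_le_one) x)

theorem classWeight_act (hS : Equivalence S) {g : Γ} {x : X} (h : S x (A.act g x)) (γ : Γ) :
    A.classWeight S (A.act g x) γ = A.classWeight S x (g⁻¹ * γ) := by
  have key (δ : Γ) : {y | S y (A.act δ⁻¹ y)}.indicator (1 : X → ℝ≥0∞) (A.act g x) =
      {y | S y (A.act (g⁻¹ * δ)⁻¹ y)}.indicator 1 x := by
    refine indicator_eq_indicator ?_ rfl
    simp only [mem_ofPred_eq, mul_inv_rev, inv_inv, A.act_mul]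
    exact ⟨hS.trans h, hS.trans (hS.symm h)⟩
  simp only [classWeight, key]
  congr 1
  exact (Equiv.mulLeft g⁻¹).tsum_eq fun δ => {y | S y (A.act δ⁻¹ y)}.indicator (1 : X → ℝ≥0∞) x

theorem EssentiallyFree.ae_free [Countable Γ] {A : PMPAction Γ X μ} (hA : A.EssentiallyFree) :
    ∀ᵐ x ∂μ, ∀ γ, A.act γ x = x → γ = 1 := by
  refine ae_all_iff.2 fun γ => ?_
  by_cases hγ : γ = 1
  · simp [hγ]
  · simpa [hγ, ae_iff] using hA γ hγ

/-- The average of `classWeight` over the space. -/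
noncomputable def meanWeight (A : PMPAction Γ X μ) (S : X → X → Prop) (γ : Γ) : ℝ≥0∞ :=
  ∫⁻ x, A.classWeight S x γ ∂μ

theorem tsum_meanWeight [Countable Γ] [IsProbabilityMeasure μ] (hA : A.EssentiallyFree)
    (hS : Equivalence S) (hS_meas : MeasurableSet {p : X × X | S p.1 p.2})
    (hfin : ∀ x, {y | S x y}.Finite) : ∑' γ, A.meanWeight S γ = 1 := by
  unfold meanWeight
  rw [← lintegral_tsum fun γ => (A.measurable_classWeight hS_meas γ).aemeasurable,
    lintegral_congr_ae (g := fun _ => 1)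
      (hA.ae_free.mono fun x hx => A.tsum_classWeight hS (hfin x) hx)]
  simp

/-- A translate of `meanWeight` differs from it in `ℓ¹` by at most twice the measure of the set of
points moved out of their `S`-class. -/
theorem tsum_abs_meanWeight_sub_le [Countable Γ] [IsProbabilityMeasure μ] (hA : A.EssentiallyFree)
    (hS : Equivalence S) (hS_meas : MeasurableSet {p : X × X | S p.1 p.2})
    (hfin : ∀ x, {y | S x y}.Finite) (g : Γ) :
    ∑' γ, |(A.meanWeight S (g⁻¹ * γ)).toReal - (A.meanWeight S γ).toReal| ≤
      (2 * μ {x | ¬ S x (A.act g x)}).toReal := by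
  set B : Set X := {x | S x (A.act g x)}
  have hB : MeasurableSet B := A.measurableSet_rel_act hS_meas g
  have hmeas := A.measurable_classWeight hS_meas
  have hact := (A.measurePreserving g).measurable
  set e₁ : Γ → ℝ≥0∞ := fun γ => ∫⁻ x in Bᶜ, A.classWeight S x (g⁻¹ * γ) ∂μ
  set e₂ : Γ → ℝ≥0∞ := fun γ => ∫⁻ x in Bᶜ, A.classWeight S (A.act g x) γ ∂μ
  have he₁ : ∑' γ, e₁ γ ≤ μ Bᶜ := by
    rw [← lintegral_tsum fun γ => (hmeas _).aemeasurable, ← setLIntegral_one]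
    refine lintegral_mono fun x => ?_
    exact ((Equiv.mulLeft g⁻¹).tsum_eq (A.classWeight S x)).trans_le (A.tsum_classWeight_le_one x)
  have he₂ : ∑' γ, e₂ γ ≤ μ Bᶜ := by
    have hmeas_act (γ : Γ) : Measurable fun x => A.classWeight S (A.act g x) γ :=
      (hmeas γ).comp hact
    rw [← lintegral_tsum fun γ => (hmeas_act γ).aemeasurable, ← setLIntegral_one]
    exact lintegral_mono fun x => A.tsum_classWeight_le_one _
  have he : ∑' γ, (e₁ γ + e₂ γ) ≤ 2 * μ Bᶜ := by
    rw [ENNReal.tsum_add, two_mul]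
    exact add_le_add he₁ he₂
  have htop : 2 * μ Bᶜ ≠ ∞ := ENNReal.mul_ne_top ofNat_ne_top (measure_ne_top μ _)
  have hsum_top : ∑' γ, (e₁ γ + e₂ γ) ≠ ∞ := ne_top_of_le_ne_top htop he
  have split₁ (γ : Γ) : A.meanWeight S (g⁻¹ * γ) =
      (∫⁻ x in B, A.classWeight S x (g⁻¹ * γ) ∂μ) + e₁ γ := (lintegral_add_compl _ hB).symm
  have split₂ (γ : Γ) : A.meanWeight S γ =
      (∫⁻ x in B, A.classWeight S x (g⁻¹ * γ) ∂μ) + e₂ γ := by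
    rw [meanWeight, ← (A.measurePreserving g).lintegral_comp (hmeas γ), ← lintegral_add_compl _ hB]
    congr 1
    exact setLIntegral_congr_fun hB fun x hx => A.classWeight_act hS hx γ
  have hfinite (γ : Γ) : A.meanWeight S γ ≠ ∞ :=
    ENNReal.ne_top_of_tsum_ne_top
      (A.tsum_meanWeight hA hS hS_meas hfin ▸ one_ne_top) γ
  have hbound (γ : Γ) :
      |(A.meanWeight S (g⁻¹ * γ)).toReal - (A.meanWeight S γ).toReal| ≤ (e₁ γ + e₂ γ).toReal := by
    have h₁ := split₁ γ ▸ hfinite (g⁻¹ * γ)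
    have h₂ := split₂ γ ▸ hfinite γ
    obtain ⟨hc, he₁⟩ := ENNReal.add_ne_top.1 h₁
    have he₂ := (ENNReal.add_ne_top.1 h₂).2
    rw [split₁, split₂, ENNReal.toReal_add hc he₁, ENNReal.toReal_add hc he₂,
      ENNReal.toReal_add he₁ he₂, add_sub_add_left_eq_sub, abs_le]
    constructor <;> linarith [toReal_nonneg (a := e₁ γ), toReal_nonneg (a := e₂ γ)]
  have hsummable : Summable fun γ => (e₁ γ + e₂ γ).toReal := ENNReal.summable_toReal hsum_top
  calc ∑' γ, |(A.meanWeight S (g⁻¹ * γ)).toReal - (A.meanWeight S γ).toReal|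
      ≤ ∑' γ, (e₁ γ + e₂ γ).toReal :=
        (Summable.of_nonneg_of_le (fun _ => abs_nonneg _) hbound hsummable).tsum_le_tsum hbound
          hsummable
    _ = (∑' γ, (e₁ γ + e₂ γ)).toReal :=
        (ENNReal.tsum_toReal_eq (ENNReal.ne_top_of_tsum_ne_top hsum_top)).symm
    _ ≤ (2 * μ Bᶜ).toReal := ENNReal.toReal_mono htop he

/-- If increasing Borel relations exhaust the orbit relation almost everywhere, then the set of
points not related to their image under a given `g` has measure tending to zero. -/
theorem tendsto_measure_not_rel_act [IsFiniteMeasure μ] {S : ℕ → X → X → Prop} {X' : Set X}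
    (hX' : μ X'ᶜ = 0) (hS_meas : ∀ n, MeasurableSet {p : X × X | S n p.1 p.2})
    (hS_mono : ∀ n x y, S n x y → S (n + 1) x y) (g : Γ)
    (hS : ∀ x ∈ X', A.act g x ∈ X' → ∃ n, S n x (A.act g x)) :
    Tendsto (fun n => μ {x | ¬ S n x (A.act g x)}) atTop (𝓝 0) := by
  have hnull : μ (⋂ n, {x | ¬ S n x (A.act g x)}) = 0 := by
    refine measure_mono_null (fun x hx => ?_) (measure_union_null hX'
      ((A.measurePreserving g).quasiMeasurePreserving.preimage_null hX'))
    by_contra hx'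
    simp only [mem_union, mem_compl_iff, mem_preimage, not_or, not_not] at hx'
    obtain ⟨n, hn⟩ := hS x hx'.1 hx'.2
    exact mem_iInter.1 hx n hn
  rw [← hnull]
  exact tendsto_measure_iInter_atTop
    (fun n => (A.measurableSet_rel_act (hS_meas n) g).compl.nullMeasurableSet)
    (antitone_nat_of_succ_le fun n x hx h => hx (hS_mono n _ _ h)) ⟨0, measure_ne_top μ _⟩

end PMPAction

/-- If a countable group admits an (essentially) free p.m.p. action on a standard probability
space whose orbit equivalence relation is hyperfinite, then the group is amenable. -/
theorem isAmenable_of_free_hyperfinite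
    {Γ : Type} [Group Γ] [Countable Γ]
    {X : Type} [MeasurableSpace X] [StandardBorelSpace X]
    {μ : Measure X} [IsProbabilityMeasure μ]
    (A : PMPAction Γ X μ) (hfree : A.EssentiallyFree) (R : PMPRel X μ)
    (hR : ∀ x y, R.rel x y ↔ ∃ γ : Γ, A.act γ x = y)
    (hhyp : R.IsHyperfinite) :
    IsAmenable Γ := by
  obtain ⟨S, X', hX', hS, hS_meas, hfin, hmono, -, hexhaust⟩ := hhyp
  have hsum (n : ℕ) := A.tsum_meanWeight hfree (hS n) (hS_meas n) (hfin n)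
  have hne_top (n : ℕ) : ∑' γ, A.meanWeight (S n) γ ≠ ∞ := hsum n ▸ one_ne_top
  refine isAmenable_of_reiter (fun n γ => (A.meanWeight (S n) γ).toReal)
    (fun _ _ => toReal_nonneg) (fun n => ?_) fun g => ?_
  · have h := (ENNReal.summable_toReal (hne_top n)).hasSum
    rwa [← ENNReal.tsum_toReal_eq (ENNReal.ne_top_of_tsum_ne_top (hne_top n)), hsum n,
      toReal_one] at h
  · refine squeeze_zero (fun n => tsum_nonneg fun _ => abs_nonneg _)
      (fun n => A.tsum_abs_meanWeight_sub_le hfree (hS n) (hS_meas n) (hfin n) g) ?_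
    have h := A.tendsto_measure_not_rel_act hX' hS_meas hmono g fun x hx hgx =>
      hexhaust x hx _ hgx ((hR _ _).2 ⟨g, rfl⟩)
    have h' := ENNReal.Tendsto.const_mul h (.inr (ofNat_ne_top (n := 2)))
    rw [mul_zero] at h'
    exact (ENNReal.tendsto_toReal zero_ne_top).comp h'
end

section
/- A countable infinite group Γ has Kazhdan's property (T) if and only if every ergodic probability-measure-preserving action of Γ on a standard non-atomic probability space is strongly ergodic. -/
open MeasureTheory Filter Topology Set ENNReal BoundedContinuousFunction

/-- A group has **Kazhdan's property (T)** if every unitary representation (on a complex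
Hilbert space) which almost has invariant vectors (for every finite subset and `ε > 0` there
is an `(F,ε)`-invariant unit vector) has a nonzero invariant vector. -/
def HasPropertyT (Γ : Type*) [Group Γ] : Prop :=
  ∀ (H : Type) (_ : NormedAddCommGroup H) (_ : InnerProductSpace ℂ H) (_ : CompleteSpace H)
    (π : Γ →* (H ≃ₗᵢ[ℂ] H)),
    (∀ (F : Finset Γ) (ε : ℝ), 0 < ε →
      ∃ v : H, ‖v‖ = 1 ∧ ∀ γ ∈ F, ‖π γ v - v‖ < ε) →
    ∃ v : H, v ≠ 0 ∧ ∀ γ : Γ, π γ v = v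

namespace HasPropertyT

/-- A group with property (T) has an invariant vector in every invariant closed subspace of a
unitary representation that almost has invariant vectors. -/
theorem exists_invariant_mem {Γ : Type*} [Group Γ] (hT : HasPropertyT Γ)
    {E : Type} [NormedAddCommGroup E] [InnerProductSpace ℂ E] (S : Submodule ℂ E)
    [CompleteSpace S] (ρ : Γ → E →ₗᵢ[ℂ] E) (h_one : ∀ x, ρ 1 x = x)
    (h_mul : ∀ γ δ x, ρ (γ * δ) x = ρ γ (ρ δ x)) (hS : ∀ γ, ∀ x ∈ S, ρ γ x ∈ S)
    (h : ∀ (F : Finset Γ) (ε : ℝ), 0 < ε →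
      ∃ v ∈ S, v ≠ 0 ∧ ∀ γ ∈ F, ‖ρ γ v - v‖ < ε * ‖v‖) :
    ∃ v ∈ S, v ≠ 0 ∧ ∀ γ, ρ γ v = v := by
  let r : Γ → S →ₗᵢ[ℂ] S := fun γ =>
    ⟨(ρ γ).toLinearMap.restrict (hS γ), fun x => (ρ γ).norm_map x⟩
  have r_coe : ∀ γ (x : S), (r γ x : E) = ρ γ x := fun γ x => rfl
  let π : Γ →* (S ≃ₗᵢ[ℂ] S) :=
    { toFun := fun γ => LinearIsometryEquiv.ofSurjective (r γ) fun x =>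
        ⟨r γ⁻¹ x, Subtype.ext (by rw [r_coe, r_coe, ← h_mul, mul_inv_cancel, h_one])⟩
      map_one' := by
        ext x
        exact h_one x
      map_mul' := fun γ δ => by
        ext x
        exact h_mul γ δ x }
  have π_coe : ∀ γ (x : S), (π γ x : E) = ρ γ x := fun γ x => rfl
  obtain ⟨v, hv0, hv⟩ := hT S inferInstance inferInstance inferInstance π fun F ε hε => by
    obtain ⟨v, hvS, hv0, hv⟩ := h F ε hε
    have hn : 0 < ‖v‖ := norm_pos_iff.2 hv0
    refine ⟨((‖v‖⁻¹ : ℝ) : ℂ) • ⟨v, hvS⟩, ?_, fun γ hγ => ?_⟩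
    · rw [norm_smul, Complex.norm_real, norm_inv, norm_norm]
      exact inv_mul_cancel₀ hn.ne'
    · rw [map_smul, ← smul_sub, norm_smul, Complex.norm_real, norm_inv, norm_norm,
        inv_mul_lt_iff₀ hn, mul_comm]
      exact hv γ hγ
  refine ⟨v, v.2, fun h0 => hv0 (Subtype.ext h0), fun γ => ?_⟩
  rw [← π_coe, hv]

end HasPropertyT

namespace PMPAction

variable {Γ : Type*} [Group Γ] {X : Type*} [MeasurableSpace X] {μ : Measure X}

theorem measurable_act (A : PMPAction Γ X μ) (γ : Γ) : Measurable (A.act γ) :=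
  (A.measurePreserving γ).measurable

theorem act_act_inv (A : PMPAction Γ X μ) (γ : Γ) (x : X) : A.act γ (A.act γ⁻¹ x) = x := by
  rw [← A.act_mul, mul_inv_cancel, A.act_one]

theorem act_inv_act (A : PMPAction Γ X μ) (γ : Γ) (x : X) : A.act γ⁻¹ (A.act γ x) = x := by
  rw [← A.act_mul, inv_mul_cancel, A.act_one]

theorem image_act (A : PMPAction Γ X μ) (γ : Γ) (B : Set X) :
    A.act γ '' B = A.act γ⁻¹ ⁻¹' B :=
  congrFun (Set.image_eq_preimage_of_inverse (A.act_inv_act γ) (A.act_act_inv γ)) B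

/-- For an ergodic action of a countable group, almost invariant sets are null or conull. -/
theorem IsErgodic.ae_mem_or_ae_notMem [Countable Γ] {A : PMPAction Γ X μ} (hA : A.IsErgodic)
    {B : Set X} (hB : MeasurableSet B) (h : ∀ γ, A.act γ ⁻¹' B =ᵐ[μ] B) :
    (∀ᵐ x ∂μ, x ∈ B) ∨ ∀ᵐ x ∂μ, x ∉ B := by
  set C : Set X := ⋂ γ, A.act γ ⁻¹' B with hC
  have hCB : C =ᵐ[μ] B := by
    have h' : ∀ᵐ x ∂μ, ∀ γ, (A.act γ x ∈ B ↔ x ∈ B) :=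
      ae_all_iff.2 fun γ => (h γ).mem_iff
    filter_upwards [h'] with x hx
    refine propext ⟨fun hxC => ?_, fun hxB => Set.mem_iInter.2 fun γ => (hx γ).2 hxB⟩
    have := Set.mem_iInter.1 hxC 1
    rwa [Set.mem_preimage, A.act_one] at this
  have hCm : MeasurableSet C := MeasurableSet.iInter fun γ => A.measurable_act γ hB
  rcases hA C hCm fun γ x hx => Set.mem_iInter.2 fun δ => by
      have := Set.mem_iInter.1 hx (δ * γ)
      rwa [Set.mem_preimage, A.act_mul] at this with h0 | h0
  · right
    have : ∀ᵐ x ∂μ, x ∉ C := measure_eq_zero_iff_ae_notMem.1 h0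
    filter_upwards [hCB.mem_iff, this] with x hx h2
    rwa [← hx]
  · left
    have : ∀ᵐ x ∂μ, x ∈ C := h0
    filter_upwards [hCB.mem_iff, this] with x hx h2
    rwa [← hx]

/-- For an ergodic action of a countable group, almost invariant functions are almost everywhere
constant. -/
theorem IsErgodic.ae_eq_const [Countable Γ] {A : PMPAction Γ X μ} (hA : A.IsErgodic)
    {f : X → ℂ} (hf : AEStronglyMeasurable f μ) (h : ∀ γ, f ∘ A.act γ =ᵐ[μ] f) :
    ∃ c, f =ᵐ[μ] Function.const X c := by
  have hg := hf.ae_eq_mk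
  set g := hf.mk f with hg_def
  have hgm : Measurable g := hf.stronglyMeasurable_mk.measurable
  have hgi : ∀ γ, g ∘ A.act γ =ᵐ[μ] g := fun γ =>
    (((A.measurePreserving γ).quasiMeasurePreserving.ae_eq_comp hg).symm.trans (h γ)).trans hg
  obtain ⟨c, hc⟩ := exists_eventuallyEq_const_of_forall_separating (l := ae μ) (f := g)
    MeasurableSet fun U hU => hA.ae_mem_or_ae_notMem (hgm hU) fun γ => by
      filter_upwards [hgi γ] with x hx
      have hx' : g (A.act γ x) = g x := hx
      refine propext ?_
      change g (A.act γ x) ∈ U ↔ g x ∈ U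
      rw [hx']
  exact ⟨c, hg.trans hc⟩

section Koopman

variable (A : PMPAction Γ X μ)

/-- The Koopman representation of an action on `L²`. -/
noncomputable def koopman (γ : Γ) : Lp ℂ 2 μ →ₗᵢ[ℂ] Lp ℂ 2 μ :=
  Lp.compMeasurePreservingₗᵢ ℂ (A.act γ⁻¹) (A.measurePreserving γ⁻¹)

theorem koopman_coeFn (γ : Γ) (f : Lp ℂ 2 μ) : A.koopman γ f =ᵐ[μ] f ∘ A.act γ⁻¹ :=
  Lp.coeFn_compMeasurePreserving f (A.measurePreserving γ⁻¹)

theorem koopman_one (f : Lp ℂ 2 μ) : A.koopman 1 f = f := by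
  refine Lp.ext ((A.koopman_coeFn 1 f).trans (.of_forall fun x => ?_))
  rw [Function.comp_apply, inv_one, A.act_one]

theorem koopman_mul (γ δ : Γ) (f : Lp ℂ 2 μ) :
    A.koopman (γ * δ) f = A.koopman γ (A.koopman δ f) := by
  refine Lp.ext ((A.koopman_coeFn _ f).trans (((A.koopman_coeFn γ _).trans
    ((A.measurePreserving γ⁻¹).quasiMeasurePreserving.ae_eq_comp
      (A.koopman_coeFn δ f))).trans (.of_forall fun x => ?_)).symm)
  simp only [Function.comp_apply, mul_inv_rev, A.act_mul]

theorem koopman_integral (γ : Γ) (f : Lp ℂ 2 μ) : ∫ x, A.koopman γ f x ∂μ = ∫ x, f x ∂μ := by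
  rw [integral_congr_ae (A.koopman_coeFn γ f)]
  have hmp := A.measurePreserving γ⁻¹
  have := integral_map (μ := μ) hmp.measurable.aemeasurable (f := f)
    (by rw [hmp.map_eq]; exact Lp.aestronglyMeasurable f)
  rw [hmp.map_eq] at this
  exact this.symm

end Koopman

theorem IsErgodic.stronglyErgodic [Countable Γ] {X : Type} [MeasurableSpace X] {μ : Measure X}
    [IsProbabilityMeasure μ] (hT : HasPropertyT Γ) {A : PMPAction Γ X μ}
    (hA : A.IsErgodic) : A.StronglyErgodic := by
  intro B hB hinv
  by_contra hlim
  let one : Lp ℂ 2 μ := indicatorConstLp 2 MeasurableSet.univ (measure_ne_top μ univ) 1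
  have one_coe : one =ᵐ[μ] fun _ => 1 := by
    filter_upwards [indicatorConstLp_coeFn (μ := μ) (p := 2) (hs := MeasurableSet.univ)
      (hμs := measure_ne_top μ univ) (c := (1 : ℂ))] with x hx
    rw [show one x = _ from hx, Set.indicator_univ]
  let S : Submodule ℂ (Lp ℂ 2 μ) := (ℂ ∙ one)ᗮ
  have mem_S : ∀ f : Lp ℂ 2 μ, f ∈ S ↔ ∫ x, f x ∂μ = 0 := fun f => by
    rw [Submodule.mem_orthogonal_singleton_iff_inner_right, L2.inner_indicatorConstLp_one,
      setIntegral_univ]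
  have tsub : ∀ n, μ (B n) * (1 - μ (B n)) =
      ENNReal.ofReal (μ.real (B n) * (1 - μ.real (B n))) := fun n => by
    rw [ENNReal.ofReal_mul measureReal_nonneg, ENNReal.ofReal_sub _ measureReal_nonneg,
      ofReal_measureReal, ENNReal.ofReal_one]
  obtain ⟨c, hc, hfreq⟩ : ∃ c : ℝ, 0 < c ∧
      ∃ᶠ n in atTop, c ≤ μ.real (B n) * (1 - μ.real (B n)) := by
    by_contra! hcon
    refine hlim ?_
    simp_rw [tsub]
    rw [← ENNReal.ofReal_zero]
    refine (ENNReal.continuous_ofReal.tendsto 0).comp ?_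
    rw [Metric.tendsto_nhds]
    intro ε hε
    have := hcon ε hε
    filter_upwards [this] with n hn
    have h0 : 0 ≤ μ.real (B n) * (1 - μ.real (B n)) :=
      mul_nonneg measureReal_nonneg (sub_nonneg.2 measureReal_le_one)
    rw [Real.dist_eq, sub_zero, abs_of_nonneg h0]
    exact hn
  let ind : ℕ → Lp ℂ 2 μ := fun n => indicatorConstLp 2 (hB n) (measure_ne_top μ _) 1
  have ind_coe : ∀ n, ind n =ᵐ[μ] (B n).indicator fun _ => 1 := fun n => indicatorConstLp_coeFn
  let v : ℕ → Lp ℂ 2 μ := fun n => ind n - (μ.real (B n) : ℂ) • one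
  have v_coe : ∀ n, v n =ᵐ[μ] fun x => (B n).indicator (fun _ => 1) x - (μ.real (B n) : ℂ) := by
    intro n
    filter_upwards [Lp.coeFn_sub (ind n) ((μ.real (B n) : ℂ) • one),
      Lp.coeFn_smul (μ.real (B n) : ℂ) one, one_coe, ind_coe n] with x h1 h2 h3 h4
    rw [h1, Pi.sub_apply, h2, Pi.smul_apply, h3, h4, smul_eq_mul, mul_one]
  have norm_sq : ∀ f : Lp ℂ 2 μ, ‖f‖ ^ 2 = ∫ x, ‖f x‖ ^ 2 ∂μ := fun f => by
    have h1 := inner_self_eq_norm_sq_to_K (𝕜 := ℂ) f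
    rw [L2.inner_def] at h1
    simp_rw [inner_self_eq_norm_sq_to_K] at h1
    have h2 : ((‖f‖ ^ 2 : ℝ) : ℂ) = ((∫ x, ‖f x‖ ^ 2 ∂μ : ℝ) : ℂ) := by
      rw [← integral_complex_ofReal]
      push_cast
      exact h1.symm
    exact_mod_cast h2
  have v_norm : ∀ n, ‖v n‖ ^ 2 = μ.real (B n) * (1 - μ.real (B n)) := by
    intro n
    rw [norm_sq]
    have : (fun x => ‖v n x‖ ^ 2) =ᵐ[μ] fun x =>
        (B n).indicator (fun _ => 1 - 2 * μ.real (B n)) x + μ.real (B n) ^ 2 := by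
      filter_upwards [v_coe n] with x hx
      rw [hx]
      by_cases hxB : x ∈ B n
      · simp only [Set.indicator_of_mem hxB]
        rw [← Complex.ofReal_one, ← Complex.ofReal_sub, Complex.norm_real, Real.norm_eq_abs,
          sq_abs]
        ring
      · simp [Set.indicator_of_notMem hxB]
    rw [integral_congr_ae this, integral_add ((integrable_const _).indicator (hB n))
      (integrable_const _), integral_indicator_const _ (hB n), integral_const]
    simp
    ring
  have v_mem : ∀ n, v n ∈ S := by
    intro n
    rw [mem_S, integral_congr_ae (v_coe n), integral_sub ((integrable_const _).indicator (hB n))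
      (integrable_const _), integral_indicator_const _ (hB n), integral_const]
    simp
  have v_diff : ∀ γ n, ‖A.koopman γ (v n) - v n‖ ^ 2 =
      μ.real (symmDiff (B n) (A.act γ '' B n)) := by
    intro γ n
    rw [norm_sq]
    have hm : MeasurableSet (A.act γ '' B n) := by
      rw [A.image_act]
      exact A.measurable_act _ (hB n)
    have : (fun x => ‖(A.koopman γ (v n) - v n : Lp ℂ 2 μ) x‖ ^ 2) =ᵐ[μ]
        (symmDiff (B n) (A.act γ '' B n)).indicator (fun _ => 1) := by
      filter_upwards [v_coe n, A.koopman_coeFn γ (v n), Lp.coeFn_sub (A.koopman γ (v n)) (v n),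
        (A.measurePreserving γ⁻¹).quasiMeasurePreserving.ae_eq_comp (v_coe n)] with x h1 h2 h3 h4
      rw [h3, Pi.sub_apply, h2, h4, h1, Function.comp_apply, sub_sub_sub_cancel_right]
      have hx : x ∈ A.act γ '' B n ↔ A.act γ⁻¹ x ∈ B n := by rw [A.image_act]; rfl
      by_cases hxB : x ∈ B n <;> by_cases hxB' : A.act γ⁻¹ x ∈ B n <;>
        simp [Set.indicator, Set.mem_symmDiff, hx, hxB, hxB']
    rw [integral_congr_ae this, integral_indicator_const _ ((hB n).symmDiff hm)]
    simp
  obtain ⟨f, hfS, hf0, hf⟩ := hT.exists_invariant_mem S A.koopman A.koopman_one A.koopman_mul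
    (fun γ f hf => by rwa [mem_S, A.koopman_integral, ← mem_S]) fun F ε hε => by
      have hev : ∀ᶠ n in atTop, ∀ γ ∈ F,
          μ.real (symmDiff (B n) (A.act γ '' B n)) < ε ^ 2 * c := by
        rw [Finset.eventually_all]
        intro γ _
        have h1 := (ENNReal.tendsto_toReal ENNReal.zero_ne_top).comp (hinv γ)
        exact h1.eventually_lt_const (by rw [ENNReal.toReal_zero]; positivity)
      obtain ⟨n, hn, hnF⟩ := (hfreq.and_eventually hev).exists
      rw [← v_norm] at hn
      have hv0 : v n ≠ 0 := fun h0 => by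
        rw [h0, norm_zero] at hn
        linarith
      refine ⟨v n, v_mem n, hv0, fun γ hγ => ?_⟩
      refine lt_of_pow_lt_pow_left₀ 2 (by positivity) ?_
      rw [v_diff, mul_pow]
      exact (hnF γ hγ).trans_le (by gcongr)
  obtain ⟨a, ha⟩ := hA.ae_eq_const (Lp.aestronglyMeasurable f) fun γ => by
    have := A.koopman_coeFn γ⁻¹ f
    rw [hf, inv_inv] at this
    exact this.symm
  refine hf0 (Lp.ext (ha.trans (.trans ?_ (Lp.coeFn_zero ℂ 2 μ).symm)))
  have := (mem_S f).1 hfS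
  rw [integral_congr_ae ha] at this
  have ha0 : a = 0 := by simpa using this
  exact .of_forall fun x => ha0

end PMPAction

section GaussianField

open Finsupp ProbabilityTheory

variable {ι : Type*}

theorem measurable_linearCombination_apply (s : ι →₀ ℝ) :
    Measurable fun x : ι → ℝ => linearCombination ℝ x s := by
  simp only [linearCombination_apply, Finsupp.sum, smul_eq_mul]
  fun_prop

theorem measurable_cexp_linearCombination (s : ι →₀ ℝ) :
    Measurable fun x : ι → ℝ => Complex.exp (linearCombination ℝ x s * Complex.I) :=
  Complex.measurable_exp.comp ((Complex.measurable_ofReal.comp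
    (measurable_linearCombination_apply s)).mul_const _)

/-- A finite measure on `ι → ℝ` is determined by its Fourier transform at finitely supported
vectors. -/
theorem MeasureTheory.Measure.ext_of_integral_cexp_linearCombination
    {μ ν : Measure (ι → ℝ)} [IsFiniteMeasure μ] [IsFiniteMeasure ν]
    (h : ∀ s : ι →₀ ℝ, ∫ x, Complex.exp (linearCombination ℝ x s * Complex.I) ∂μ =
      ∫ x, Complex.exp (linearCombination ℝ x s * Complex.I) ∂ν) : μ = ν := by
  refine IsProjectiveLimit.unique (P := fun J : Finset ι => μ.map J.restrict) (fun _ => rfl)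
    fun J => Eq.symm ?_
  refine Measure.ext_of_charFunDual (funext fun L => ?_)
  classical
  have key : ∀ x : ι → ℝ, L (J.restrict x) =
      linearCombination ℝ x (∑ j : J, Finsupp.single (j : ι) (L (Pi.single j 1))) := fun x => by
    rw [_root_.map_sum]
    simp only [linearCombination_single, smul_eq_mul]
    conv_lhs => rw [← Finset.univ_sum_single (J.restrict x), _root_.map_sum]
    refine Finset.sum_congr rfl fun j _ => ?_
    have : Pi.single j (J.restrict x j) = x j • (Pi.single j 1 : J → ℝ) := by
      rw [← Pi.single_smul', smul_eq_mul, mul_one]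
      rfl
    rw [this, map_smul, smul_eq_mul, mul_comm]
  have hm : ∀ ρ : Measure (J → ℝ), AEStronglyMeasurable
      (fun y : J → ℝ => Complex.exp (L y * Complex.I)) ρ := fun ρ =>
    (by fun_prop : Continuous fun y : J → ℝ => Complex.exp (L y * Complex.I)).aestronglyMeasurable
  rw [charFunDual_apply, charFunDual_apply, integral_map (by fun_prop) (hm _),
    integral_map (by fun_prop) (hm _)]
  simp only [key]
  exact h _

variable {E : Type*} [NormedAddCommGroup E] [InnerProductSpace ℝ E]

/-- The measure `μ` on `ι → ℝ` is the law of a centered Gaussian process whose covariance is the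
Gram matrix of `w`. -/
def IsGaussianLawOf (w : ι → E) (μ : Measure (ι → ℝ)) : Prop :=
  ∀ s : ι →₀ ℝ, ∫ x, Complex.exp (linearCombination ℝ x s * Complex.I) ∂μ =
    Complex.exp (-(‖linearCombination ℝ w s‖ ^ 2 / 2 : ℝ))

theorem isGaussianLawOf_infinitePi_of_orthogonal (g : ℕ → E)
    (hg : Pairwise fun i j => inner ℝ (g i) (g j) = 0) :
    IsGaussianLawOf g (Measure.infinitePi fun n => gaussianReal 0 (‖g n‖₊ ^ 2)) := by
  intro s
  have h1 : ∀ x : ℕ → ℝ, Complex.exp (linearCombination ℝ x s * Complex.I) =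
      ∏ n : s.support, Complex.exp ((s n * s.support.restrict x n : ℝ) * Complex.I) := fun x => by
    rw [← Complex.exp_sum, ← Finset.sum_mul, linearCombination_apply, Finsupp.sum,
      ← Finset.sum_coe_sort]
    simp only [smul_eq_mul, Complex.ofReal_sum]
    rfl
  have h2 : ‖linearCombination ℝ g s‖ ^ 2 = ∑ n : s.support, s n ^ 2 * ‖g n‖ ^ 2 := by
    rw [← real_inner_self_eq_norm_sq, linearCombination_apply, Finsupp.sum, sum_inner,
      Finset.sum_coe_sort s.support fun n => s n ^ 2 * ‖g n‖ ^ 2]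
    refine Finset.sum_congr rfl fun n hn => ?_
    rw [inner_sum, Finset.sum_eq_single n]
    · rw [real_inner_smul_left, real_inner_smul_right, real_inner_self_eq_norm_sq]
      ring
    · intro m _ hmn
      rw [real_inner_smul_left, real_inner_smul_right, hg hmn.symm]
      ring
    · exact fun h => absurd hn h
  simp only [h1]
  rw [integral_restrict_infinitePi (X := fun _ => ℝ) (s := s.support)
    (fun n => gaussianReal 0 (‖g n‖₊ ^ 2))
    (f := fun y => ∏ n : s.support, Complex.exp ((s n * y n : ℝ) * Complex.I))
    (Continuous.aestronglyMeasurable (by fun_prop)), integral_fintype_prod_eq_prod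
      (f := fun (n : s.support) (t : ℝ) => Complex.exp ((s n * t : ℝ) * Complex.I)), h2,
    Finset.sum_div, Complex.ofReal_sum, ← Finset.sum_neg_distrib, Complex.exp_sum]
  refine Finset.prod_congr rfl fun n _ => ?_
  have := charFun_gaussianReal (μ := 0) (v := ‖g n‖₊ ^ 2) (s n)
  rw [charFun_apply_real] at this
  push_cast at this ⊢
  rw [this]
  congr 1
  simp
  ring

/-- Every countable family of vectors in a real inner product space has a Gaussian model. -/
theorem exists_isGaussianLawOf [Countable ι] (w : ι → E) :
    ∃ μ : Measure (ι → ℝ), IsProbabilityMeasure μ ∧ IsGaussianLawOf w μ := by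
  obtain ⟨f, hf⟩ := exists_injective_nat ι
  let v : ℕ → E := Function.extend f w 0
  let g : ℕ → E := InnerProductSpace.gramSchmidt ℝ v
  have hc : ∀ i, ∃ c : ℕ →₀ ℝ, linearCombination ℝ g c = w i := fun i => by
    rw [← LinearMap.mem_range, Finsupp.range_linearCombination,
      InnerProductSpace.span_gramSchmidt]
    exact Submodule.subset_span ⟨f i, hf.extend_apply _ _ i⟩
  choose c hc using hc
  have hP := isGaussianLawOf_infinitePi_of_orthogonal g
    (InnerProductSpace.gramSchmidt_pairwise_orthogonal ℝ v)
  set P := Measure.infinitePi fun n => gaussianReal 0 (‖g n‖₊ ^ 2)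
  let Φ : (ℕ → ℝ) → ι → ℝ := fun x i => linearCombination ℝ x (c i)
  have hΦ : Measurable Φ := measurable_pi_lambda _ fun i => measurable_linearCombination_apply _
  refine ⟨P.map Φ, Measure.isProbabilityMeasure_map hΦ.aemeasurable, fun s => ?_⟩
  rw [integral_map hΦ.aemeasurable (measurable_cexp_linearCombination s).aestronglyMeasurable]
  have h1 : ∀ x : ℕ → ℝ, linearCombination ℝ (Φ x) s =
      linearCombination ℝ x (linearCombination ℝ c s) := fun x => by
    rw [Finsupp.apply_linearCombination]
    rfl
  have h2 : linearCombination ℝ w s = linearCombination ℝ g (linearCombination ℝ c s) := by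
    rw [Finsupp.apply_linearCombination]
    congr 2
    exact (funext hc).symm
  simp only [h1, h2]
  exact hP _

namespace IsGaussianLawOf

variable {w : ι → E} {μ : Measure (ι → ℝ)} [IsProbabilityMeasure μ]

theorem map_linearCombination (h : IsGaussianLawOf w μ) (s : ι →₀ ℝ) :
    μ.map (fun x => linearCombination ℝ x s) =
      gaussianReal 0 (‖linearCombination ℝ w s‖₊ ^ 2) := by
  have hm := measurable_linearCombination_apply s
  have := Measure.isProbabilityMeasure_map (μ := μ) hm.aemeasurable
  refine Measure.ext_of_charFun (funext fun t => ?_)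
  rw [charFun_apply_real, charFun_gaussianReal, integral_map hm.aemeasurable
    (by fun_prop)]
  have h1 := h (t • s)
  simp only [map_smul, smul_eq_mul, norm_smul, Real.norm_eq_abs, mul_pow, sq_abs] at h1
  push_cast at h1 ⊢
  rw [h1]
  congr 1
  simp
  ring

theorem map_eval (h : IsGaussianLawOf w μ) (i : ι) (hi : ‖w i‖ = 1) :
    μ.map (fun x => x i) = gaussianReal 0 1 := by
  have := h.map_linearCombination (Finsupp.single i 1)
  simp only [linearCombination_single, one_smul] at this
  rw [this]
  congr
  ext
  simp [hi]

end IsGaussianLawOf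

end GaussianField

/-- If a bounded sequence in a Hilbert space is asymptotically orthogonal to each of its terms,
then it converges weakly to zero; in particular it cannot have a constant nonzero inner product
with a fixed vector. -/
theorem eq_zero_of_inner_eq_of_tendsto_inner_zero {E : Type*} [NormedAddCommGroup E]
    [InnerProductSpace ℂ E] [CompleteSpace E] {x : ℕ → E} {C : ℝ} (hC : ∀ k, ‖x k‖ ≤ C)
    (hx : ∀ l, Tendsto (fun k => inner ℂ (x l) (x k)) atTop (𝓝 0)) {y : E} {a : ℂ}
    (hy : ∀ k, inner ℂ y (x k) = a) : a = 0 := by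
  set K := (Submodule.span ℂ (Set.range x)).topologicalClosure with hK
  have : CompleteSpace K := (Submodule.isClosed_topologicalClosure _).completeSpace_coe
  set p : E := K.starProjection y with hp
  have hxK : ∀ k, x k ∈ K := fun k =>
    Submodule.le_topologicalClosure _ (Submodule.subset_span ⟨k, rfl⟩)
  have hpK : p ∈ K := Submodule.starProjection_apply_mem K y
  have hpa : ∀ k, inner ℂ p (x k) = a := fun k => by
    rw [← hy k, ← sub_eq_zero, ← inner_sub_left, ← neg_sub, inner_neg_left, neg_eq_zero]
    exact Submodule.inner_left_of_mem_orthogonal (hxK k)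
      (Submodule.sub_starProjection_mem_orthogonal y)
  have hspan : ∀ q ∈ Submodule.span ℂ (Set.range x),
      Tendsto (fun k => inner ℂ q (x k)) atTop (𝓝 0) := fun q hq => by
    induction hq using Submodule.span_induction with
    | mem q hq =>
      obtain ⟨l, rfl⟩ := hq
      exact hx l
    | zero => simp
    | add q r _ _ hq hr => simpa [inner_add_left] using hq.add hr
    | smul b q _ hq => simpa [inner_smul_left, mul_comm] using hq.const_mul ((starRingEnd ℂ) b)
  have hC0 : 0 ≤ C := (norm_nonneg _).trans (hC 0)
  refine norm_le_zero_iff.1 (le_of_forall_pos_le_add fun ε hε => ?_)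
  obtain ⟨q, hq, hqp⟩ := Metric.mem_closure_iff.1
    (show p ∈ closure (Submodule.span ℂ (Set.range x) : Set E) from hpK)
    (ε / (C + 1)) (by positivity)
  rw [zero_add]
  have hbound : ∀ k, ‖a‖ ≤ ε + ‖inner ℂ q (x k)‖ := fun k => by
    have h1 : a = inner ℂ (p - q) (x k) + inner ℂ q (x k) := by
      rw [← inner_add_left, sub_add_cancel, hpa]
    calc ‖a‖ ≤ ‖inner ℂ (p - q) (x k)‖ + ‖inner ℂ q (x k)‖ := by
          conv_lhs => rw [h1]
          exact norm_add_le _ _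
      _ ≤ ε + ‖inner ℂ q (x k)‖ := by
          gcongr
          calc ‖inner ℂ (p - q) (x k)‖ ≤ ‖p - q‖ * ‖x k‖ := norm_inner_le_norm _ _
            _ ≤ ε / (C + 1) * (C + 1) := by
                rw [← dist_eq_norm]
                gcongr
                exact (hC k).trans (by linarith)
            _ = ε := by field_simp
  refine ge_of_tendsto (x := atTop) (f := fun k => ε + ‖inner ℂ q (x k)‖) ?_
    (Filter.Eventually.of_forall hbound)
  simpa using (hspan q hq).norm.const_add ε

section GaussianAction

open Finsupp ProbabilityTheory

variable {Γ ι E : Type*} [Group Γ] [MulAction Γ ι] [NormedAddCommGroup E] [InnerProductSpace ℝ E]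
  {w : ι → E} {μ : Measure (ι → ℝ)}

theorem inner_linearCombination_linearCombination (v w : ι → E) (s t : ι →₀ ℝ) :
    inner ℝ (linearCombination ℝ v s) (linearCombination ℝ w t) =
      ∑ i ∈ s.support, ∑ j ∈ t.support, s i * (t j * inner ℝ (v i) (w j)) := by
  simp only [linearCombination_apply, Finsupp.sum, sum_inner, inner_sum, real_inner_smul_left,
    real_inner_smul_right]
  rw [Finset.sum_comm]
  exact Finset.sum_congr rfl fun _ _ => Finset.sum_congr rfl fun _ _ => by ring

theorem linearCombination_mapDomain_smul (w : ι → E) (γ : Γ) (s : ι →₀ ℝ) :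
    linearCombination ℝ w (mapDomain (γ • ·) s) = linearCombination ℝ (fun i => w (γ • i)) s :=
  linearCombination_mapDomain ℝ _ _

theorem norm_linearCombination_mapDomain_smul
    (hw : ∀ (γ : Γ) i j, inner ℝ (w (γ • i)) (w (γ • j)) = inner ℝ (w i) (w j)) (γ : Γ)
    (s : ι →₀ ℝ) :
    ‖linearCombination ℝ w (mapDomain (γ • ·) s)‖ = ‖linearCombination ℝ w s‖ := by
  rw [linearCombination_mapDomain_smul, ← sq_eq_sq₀ (norm_nonneg _) (norm_nonneg _),
    ← real_inner_self_eq_norm_sq, ← real_inner_self_eq_norm_sq,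
    inner_linearCombination_linearCombination, inner_linearCombination_linearCombination]
  simp only [hw]

theorem linearCombination_smul_inv (x : ι → ℝ) (γ : Γ) (s : ι →₀ ℝ) :
    linearCombination ℝ (fun i => x (γ⁻¹ • i)) s =
      linearCombination ℝ x (mapDomain (γ⁻¹ • ·) s) :=
  (linearCombination_mapDomain ℝ _ _).symm

/-- The Gaussian action attached to an action of `Γ` on the index set preserving the covariance. -/
def gaussianAction [IsProbabilityMeasure μ] (hμ : IsGaussianLawOf w μ)
    (hw : ∀ (γ : Γ) i j, inner ℝ (w (γ • i)) (w (γ • j)) = inner ℝ (w i) (w j)) :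
    PMPAction Γ (ι → ℝ) μ where
  act γ x i := x (γ⁻¹ • i)
  act_one x := by simp
  act_mul γ δ x := by simp [mul_smul]
  measurePreserving γ := by
    have hm : Measurable fun (x : ι → ℝ) i => x (γ⁻¹ • i) := by fun_prop
    refine ⟨hm, ?_⟩
    have := Measure.isProbabilityMeasure_map (μ := μ) hm.aemeasurable
    refine Measure.ext_of_integral_cexp_linearCombination fun s => ?_
    rw [integral_map hm.aemeasurable (measurable_cexp_linearCombination s).aestronglyMeasurable]
    simp only [linearCombination_smul_inv]
    rw [hμ, hμ, norm_linearCombination_mapDomain_smul hw]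

theorem norm_cexp_linearCombination (s : ι →₀ ℝ) (x : ι → ℝ) :
    ‖Complex.exp (linearCombination ℝ x s * Complex.I)‖ = 1 :=
  Complex.norm_exp_ofReal_mul_I _

theorem integrable_cexp_linearCombination [IsFiniteMeasure μ] (s : ι →₀ ℝ) :
    Integrable (fun x : ι → ℝ => Complex.exp (linearCombination ℝ x s * Complex.I)) μ :=
  .of_bound (measurable_cexp_linearCombination s).aestronglyMeasurable 1
    (.of_forall fun x => (norm_cexp_linearCombination s x).le)

theorem conj_cexp_mul_cexp (s t : ι →₀ ℝ) (x : ι → ℝ) :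
    Complex.exp (linearCombination ℝ x t * Complex.I) *
      (starRingEnd ℂ) (Complex.exp (linearCombination ℝ x s * Complex.I)) =
      Complex.exp (linearCombination ℝ x (t - s) * Complex.I) := by
  rw [← Complex.exp_conj, ← Complex.exp_add, map_sub, map_mul, Complex.conj_ofReal,
    Complex.conj_I]
  congr 1
  push_cast
  ring

/-- A Gaussian action is ergodic as soon as some sequence of group elements sends every index to
asymptotically orthogonal positions. -/
theorem isErgodic_gaussianAction [IsProbabilityMeasure μ] (hμ : IsGaussianLawOf w μ)
    (hw : ∀ (γ : Γ) i j, inner ℝ (w (γ • i)) (w (γ • j)) = inner ℝ (w i) (w j)) (γ : ℕ → Γ)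
    (hγ : ∀ i j, Tendsto (fun k => inner ℝ (w i) (w (γ k • j))) atTop (𝓝 0)) :
    (gaussianAction hμ hw).IsErgodic := by
  intro B hB hinv
  set A := gaussianAction hμ hw with hA
  have hpre : ∀ δ, A.act δ ⁻¹' B = B := fun δ => by
    refine Set.Subset.antisymm (fun x hx => ?_) (hinv δ)
    have := hinv δ⁻¹ _ hx
    rwa [A.act_inv_act] at this
  have key : ∀ s : ι →₀ ℝ, ∫ x in B, Complex.exp (linearCombination ℝ x s * Complex.I) ∂μ =
      μ.real B * ∫ x, Complex.exp (linearCombination ℝ x s * Complex.I) ∂μ := by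
    intro s
    set c : ℝ := Real.exp (-(‖linearCombination ℝ w s‖ ^ 2 / 2)) with hc
    have hcs : ∀ k, ∫ x, Complex.exp
        (linearCombination ℝ x (mapDomain (γ k • ·) s) * Complex.I) ∂μ = c := fun k => by
      rw [hμ, norm_linearCombination_mapDomain_smul hw, hc]
      push_cast
      rfl
    have hcs' : ∫ x, Complex.exp (linearCombination ℝ x s * Complex.I) ∂μ = c := by
      rw [hμ, hc]
      push_cast
      rfl
    let f : ℕ → (ι → ℝ) → ℂ := fun k x =>
      Complex.exp (linearCombination ℝ x (mapDomain (γ k • ·) s) * Complex.I) - c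
    have hf_bound : ∀ k x, ‖f k x‖ ≤ 1 + ‖(c : ℂ)‖ := fun k x =>
      (norm_sub_le _ _).trans (by rw [norm_cexp_linearCombination])
    have hf : ∀ k, MemLp (f k) 2 μ := fun k =>
      .of_bound ((measurable_cexp_linearCombination _).sub_const _).aestronglyMeasurable _
        (.of_forall (hf_bound k))
    have hinner : ∀ l k, inner ℂ ((hf l).toLp (f l)) ((hf k).toLp (f k)) =
        ((Real.exp (-(‖linearCombination ℝ w (mapDomain (γ k • ·) s) -
          linearCombination ℝ w (mapDomain (γ l • ·) s)‖ ^ 2 / 2)) - c ^ 2 : ℝ) : ℂ) := by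
      intro l k
      have h1 : (fun x => inner ℂ ((hf l).toLp (f l) x) ((hf k).toLp (f k) x)) =ᵐ[μ] fun x =>
          (Complex.exp (linearCombination ℝ x
            (mapDomain (γ k • ·) s - mapDomain (γ l • ·) s) * Complex.I) -
          c * Complex.exp (linearCombination ℝ x (mapDomain (γ k • ·) s) * Complex.I)) -
          (c * (starRingEnd ℂ) (Complex.exp
            (linearCombination ℝ x (mapDomain (γ l • ·) s) * Complex.I)) - c ^ 2) := by
        filter_upwards [(hf l).coeFn_toLp, (hf k).coeFn_toLp] with x hl hk
        rw [hl, hk, ← conj_cexp_mul_cexp]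
        simp only [f, RCLike.inner_apply, map_sub, Complex.conj_ofReal]
        ring
      have hexp := fun s => integrable_cexp_linearCombination (μ := μ) (ι := ι) s
      have hexp_k : Integrable (fun x : ι → ℝ => (c : ℂ) * Complex.exp
          (linearCombination ℝ x (mapDomain (γ k • ·) s) * Complex.I)) μ := (hexp _).const_mul _
      have hexp_l : Integrable (fun x : ι → ℝ => (c : ℂ) * (starRingEnd ℂ) (Complex.exp
          (linearCombination ℝ x (mapDomain (γ l • ·) s) * Complex.I))) μ :=
        (Complex.conjLIE.integrable_comp_iff.2 (hexp _)).const_mul _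
      rw [L2.inner_def, integral_congr_ae h1, integral_sub, integral_sub (hexp _) hexp_k,
        integral_sub hexp_l (integrable_const _), integral_const_mul,
        integral_const_mul, integral_conj, hcs, hcs, hμ, map_sub, integral_const]
      · simp
        ring
      · exact (hexp _).sub hexp_k
      · exact hexp_l.sub (integrable_const _)
    have hbound : ∀ k, ‖(hf k).toLp (f k)‖ ≤ 1 + ‖(c : ℂ)‖ := fun k => by
      have := Lp.norm_le_of_ae_bound (f := (hf k).toLp (f k)) (C := 1 + ‖(c : ℂ)‖) (by positivity)
        (by filter_upwards [(hf k).coeFn_toLp] with x hx; rw [hx]; exact hf_bound k x)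
      simpa [measureUnivNNReal] using this
    have hlim : ∀ l, Tendsto (fun k => inner ℂ ((hf l).toLp (f l)) ((hf k).toLp (f k))) atTop
        (𝓝 0) := by
      intro l
      simp only [hinner]
      rw [← Complex.ofReal_zero]
      refine (Complex.continuous_ofReal.tendsto 0).comp ?_
      have h1 : Tendsto (fun k => inner ℝ (linearCombination ℝ w (mapDomain (γ k • ·) s))
          (linearCombination ℝ w (mapDomain (γ l • ·) s))) atTop (𝓝 0) := by
        have h2 : ∀ k, inner ℝ (linearCombination ℝ w (mapDomain (γ k • ·) s))
            (linearCombination ℝ w (mapDomain (γ l • ·) s)) =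
            ∑ i ∈ (mapDomain (γ l • ·) s).support, ∑ j ∈ s.support,
              mapDomain (γ l • ·) s i * (s j * inner ℝ (w i) (w (γ k • j))) := fun k => by
          rw [real_inner_comm, linearCombination_mapDomain_smul w (γ k)]
          exact inner_linearCombination_linearCombination _ _ _ _
        simp only [h2]
        rw [show (0 : ℝ) = ∑ i ∈ (mapDomain (γ l • ·) s).support, ∑ j ∈ s.support,
          mapDomain (γ l • ·) s i * (s j * 0) by simp]
        exact tendsto_finsetSum _ fun i _ => tendsto_finsetSum _ fun j _ =>
          ((hγ i j).const_mul _).const_mul _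
      have h3 : ∀ k, Real.exp (-(‖linearCombination ℝ w (mapDomain (γ k • ·) s) -
          linearCombination ℝ w (mapDomain (γ l • ·) s)‖ ^ 2 / 2)) - c ^ 2 =
          c ^ 2 * (Real.exp (inner ℝ (linearCombination ℝ w (mapDomain (γ k • ·) s))
          (linearCombination ℝ w (mapDomain (γ l • ·) s))) - 1) := fun k => by
        rw [mul_sub, mul_one, hc, ← Real.exp_nat_mul, ← Real.exp_add, norm_sub_sq_real,
          norm_linearCombination_mapDomain_smul hw, norm_linearCombination_mapDomain_smul hw]
        congr 2
        push_cast
        ring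
      simp only [h3]
      have h4 := (((Real.continuous_exp.tendsto 0).comp h1).sub_const 1).const_mul (c ^ 2)
      simpa using h4
    have hB_inner : ∀ k, inner ℂ (indicatorConstLp 2 hB (measure_ne_top μ B) 1)
        ((hf k).toLp (f k)) =
        ∫ x in B, Complex.exp (linearCombination ℝ x s * Complex.I) ∂μ - μ.real B * c := by
      intro k
      have h1 : ∫ x in B, Complex.exp
          (linearCombination ℝ x (mapDomain (γ k • ·) s) * Complex.I) ∂μ =
          ∫ x in B, Complex.exp (linearCombination ℝ x s * Complex.I) ∂μ := by
        have hmp := A.measurePreserving (γ k)⁻¹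
        have h2 := setIntegral_map (μ := μ) hB
          (measurable_cexp_linearCombination s).aestronglyMeasurable hmp.measurable.aemeasurable
        rw [hmp.map_eq, hpre] at h2
        rw [h2]
        have h5 : ∀ x, linearCombination ℝ (A.act (γ k)⁻¹ x) s =
            linearCombination ℝ x (mapDomain (γ k • ·) s) := fun x => by
          change linearCombination ℝ (fun i => x ((γ k)⁻¹⁻¹ • i)) s = _
          rw [linearCombination_smul_inv, inv_inv]
        simp only [h5]
      rw [L2.inner_indicatorConstLp_one, setIntegral_congr_ae hB
        ((hf k).coeFn_toLp.mono fun x hx _ => hx)]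
      simp only [f]
      rw [integral_sub (integrable_cexp_linearCombination _) (integrable_const _), h1,
        setIntegral_const]
      simp
    rw [hcs', ← sub_eq_zero]
    exact eq_zero_of_inner_eq_of_tendsto_inner_zero hbound hlim hB_inner
  have hres : μ.restrict B = μ B • μ := by
    have : IsFiniteMeasure (μ B • μ) := Measure.smul_finite μ (measure_ne_top μ B)
    refine Measure.ext_of_integral_cexp_linearCombination fun s => ?_
    rw [key, integral_smul_measure, Complex.real_smul]
    rfl
  have hsq : μ B = μ B * μ B := by
    have := congrArg (fun ν : Measure (ι → ℝ) => ν B) hres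
    simpa using this
  by_cases h0 : μ B = 0
  · exact .inl h0
  · right
    rw [prob_compl_eq_zero_iff hB]
    exact ((ENNReal.mul_eq_left h0 (measure_ne_top μ B)).1 hsq.symm)

/-- A Gaussian action is not strongly ergodic as soon as its covariance has almost invariant
unit vectors. -/
theorem not_stronglyErgodic_gaussianAction [IsProbabilityMeasure μ] (hμ : IsGaussianLawOf w μ)
    (hw : ∀ (γ : Γ) i j, inner ℝ (w (γ • i)) (w (γ • j)) = inner ℝ (w i) (w j)) (i : ℕ → ι)
    (hi : ∀ n, ‖w (i n)‖ = 1)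
    (hγ : ∀ γ : Γ, Tendsto (fun n => ‖w (γ • i n) - w (i n)‖) atTop (𝓝 0)) :
    ¬ (gaussianAction hμ hw).StronglyErgodic := by
  intro hse
  set A := gaussianAction hμ hw with hA
  have hlaw : ∀ n, ∀ S : Set ℝ, MeasurableSet S →
      μ {x | x (i n) ∈ S} = gaussianReal 0 1 S := fun n S hS => by
    rw [← hμ.map_eval (i n) (hi n), Measure.map_apply (measurable_pi_apply (i n)) hS]
    rfl
  have hpos : ∀ U : Set ℝ, IsOpen U → U.Nonempty → gaussianReal 0 1 U ≠ 0 := fun U hU hne h0 =>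
    (hU.measure_pos volume hne).ne' (gaussianReal_absolutelyContinuous' 0 one_ne_zero h0)
  let B : ℕ → Set (ι → ℝ) := fun n => {x | x (i n) ∈ Ioi 0}
  have hB : ∀ n, MeasurableSet (B n) := fun n => measurable_pi_apply (i n) measurableSet_Ioi
  have himage : ∀ γ n x, x ∈ A.act γ '' B n ↔ 0 < x (γ • i n) := fun γ n x => by
    rw [A.image_act]
    change 0 < x ((γ⁻¹)⁻¹ • i n) ↔ _
    rw [inv_inv]
  have hconst := hse B hB fun γ => ?_
  · simp only [B, hlaw _ _ measurableSet_Ioi] at hconst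
    have := tendsto_nhds_unique hconst tendsto_const_nhds
    rcases mul_eq_zero.1 this.symm with h | h
    · exact hpos _ isOpen_Ioi ⟨1, by simp⟩ h
    · rw [← prob_compl_eq_one_sub measurableSet_Ioi, compl_Ioi] at h
      exact hpos (Iio 0) isOpen_Iio ⟨-1, by simp⟩ (measure_mono_null Iio_subset_Iic_self h)
  · rw [ENNReal.tendsto_nhds_zero]
    intro ε hε
    have hε2 : 0 < ε / 2 := ENNReal.half_pos hε.ne'
    have hsmall : Tendsto (fun δ : ℝ => gaussianReal 0 1 (Icc (0 - δ) (0 + δ))) (𝓝[>] 0)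
        (𝓝 0) := by
      have := nullSingletonClass_gaussianReal (μ := 0) (v := 1) one_ne_zero
      have h1 := tendsto_measure_Icc (gaussianReal 0 1) (0 : ℝ)
      exact h1.mono_left nhdsWithin_le_nhds
    obtain ⟨δ, hδ, hδ0⟩ := ((hsmall.eventually_le_const hε2).and self_mem_nhdsWithin).exists
    have hδ0 : 0 < δ := hδ0
    have hcheb : ∀ n, μ {x | δ ≤ |x (γ • i n) - x (i n)|} ≤
        ENNReal.ofReal (‖w (γ • i n) - w (i n)‖ ^ 2 / δ ^ 2) := fun n => by
      have h1 := hμ.map_linearCombination (Finsupp.single (γ • i n) 1 - Finsupp.single (i n) 1)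
      simp only [map_sub, linearCombination_single, one_smul] at h1
      have h2 := meas_ge_le_variance_div_sq
        (memLp_id_gaussianReal (μ := 0) (v := ‖w (γ • i n) - w (i n)‖₊ ^ 2) 2) hδ0
      rw [variance_id_gaussianReal] at h2
      simp only [id, integral_id_gaussianReal, sub_zero] at h2
      rw [← h1, Measure.map_apply (by fun_prop)
        (measurableSet_le measurable_const (by fun_prop))] at h2
      simpa using h2
    have hlim : Tendsto (fun n => ENNReal.ofReal (‖w (γ • i n) - w (i n)‖ ^ 2 / δ ^ 2)) atTop
        (𝓝 0) := by
      have := ENNReal.tendsto_ofReal (((hγ γ).pow 2).div_const (δ ^ 2))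
      simpa using this
    filter_upwards [hlim.eventually_le_const hε2] with n hn
    calc μ (symmDiff (B n) (A.act γ '' B n))
        ≤ μ ({x | x (i n) ∈ Icc (0 - δ) (0 + δ)} ∪ {x | δ ≤ |x (γ • i n) - x (i n)|}) := by
          refine measure_mono fun x hx => ?_
          rw [Set.mem_symmDiff, himage] at hx
          by_contra hcon
          simp only [Set.mem_union, Set.mem_ofPred_eq, Set.mem_Icc, not_or, not_and_or, not_le,
            zero_sub, zero_add, abs_lt] at hcon
          simp only [B, Set.mem_ofPred_eq, Set.mem_Ioi, not_lt] at hx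
          obtain ⟨h1 | h1, h2, h3⟩ := hcon <;> rcases hx with ⟨h4, h5⟩ | ⟨h4, h5⟩ <;> linarith
      _ ≤ ε / 2 + ε / 2 := (measure_union_le _ _).trans (add_le_add
          (by rw [hlaw _ _ measurableSet_Icc]; exact hδ) ((hcheb n).trans hn))
      _ = ε := ENNReal.add_halves ε

end GaussianAction

section UnboundedCocycle

/-- A unitary representation with a vector that is uniformly almost fixed by the whole group has a
nonzero invariant vector. -/
theorem exists_ne_zero_forall_apply_eq_of_norm_sub_le {Γ H : Type*} [Group Γ]
    [NormedAddCommGroup H] [InnerProductSpace ℂ H] [CompleteSpace H] (π : Γ →* (H ≃ₗᵢ[ℂ] H))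
    {v : H} (hv : ‖v‖ = 1) (h : ∀ γ, ‖π γ v - v‖ ≤ 1 / 2) :
    ∃ u, u ≠ 0 ∧ ∀ γ, π γ u = u := by
  let _ : InnerProductSpace ℝ H := .complexToReal
  set O : Set H := Set.range fun γ => π γ v
  set K : Set H := closedConvexHull ℝ O
  have hOK : O ⊆ K := subset_closedConvexHull
  have hK_closed : IsClosed K := isClosed_closedConvexHull
  have hK_convex : Convex ℝ K := convex_closedConvexHull
  have hK_ball : K ⊆ Metric.closedBall v (1 / 2) :=
    closedConvexHull_min (by
      rintro _ ⟨γ, rfl⟩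
      rw [mem_closedBall_iff_norm]
      exact h γ) (convex_closedBall _ _) Metric.isClosed_closedBall
  have hK_inv : ∀ γ, ∀ x ∈ K, π γ x ∈ K := fun γ => by
    have : K ⊆ π γ ⁻¹' K := closedConvexHull_min (by
        rintro _ ⟨δ, rfl⟩
        refine hOK ⟨γ * δ, ?_⟩
        simp) (hK_convex.is_linear_preimage
          ⟨fun x y => map_add _ x y,
            fun c x => (π γ).toLinearEquiv.toLinearMap.map_smul_of_tower c x⟩)
      (hK_closed.preimage (π γ).continuous)
    exact this
  obtain ⟨u, huK, hu⟩ := exists_norm_eq_iInf_of_complete_convex ⟨_, hOK ⟨1, rfl⟩⟩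
    hK_closed.isComplete hK_convex 0
  refine ⟨u, ?_, fun γ => ?_⟩
  · rintro rfl
    have := hK_ball huK
    rw [mem_closedBall_iff_norm, zero_sub, norm_neg, hv] at this
    norm_num at this
  · have hγ : ‖0 - π γ u‖ = ⨅ w : K, ‖0 - (w : H)‖ := by
      rw [← hu, zero_sub, zero_sub, norm_neg, norm_neg, LinearIsometryEquiv.norm_map]
    have h1 := (norm_eq_iInf_iff_real_inner_le_zero hK_convex huK).1 hu _ (hK_inv γ u huK)
    have h2 := (norm_eq_iInf_iff_real_inner_le_zero hK_convex (hK_inv γ u huK)).1 hγ u huK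
    rw [← sub_eq_zero]
    refine real_inner_self_nonpos.1 ?_
    have h3 : inner ℝ (π γ u - u) (π γ u - u) =
        inner ℝ (0 - u) (π γ u - u) + inner ℝ (0 - π γ u) (u - π γ u) := by
      rw [← neg_sub (π γ u) u, inner_neg_right, ← sub_eq_add_neg, ← inner_sub_left]
      congr 1
      abel
    linarith

/-- A countable group without property (T) has an unbounded function that behaves like the orbit
of a point under an affine isometric action on a real Hilbert space. -/
theorem exists_unbounded_of_not_hasPropertyT {Γ : Type*} [Group Γ] [Countable Γ]
    (hT : ¬ HasPropertyT Γ) :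
    ∃ (E : Type) (_ : NormedAddCommGroup E) (_ : InnerProductSpace ℝ E) (b : Γ → E),
      (∀ g h, ‖b g - b h‖ = ‖b (g⁻¹ * h)‖) ∧ ∀ M : ℝ, ∃ γ, M < ‖b γ‖ := by
  simp only [HasPropertyT, not_forall] at hT
  obtain ⟨H, _, _, _, π, hπ, hno⟩ := hT
  obtain ⟨f, hf⟩ := exists_surjective_nat Γ
  classical
  choose v hv hvF using fun n : ℕ =>
    hπ ((Finset.range n).image f) ((1 / 4) ^ n) (by positivity)
  have hmem : ∀ γ, Memℓp (fun n => (2 : ℂ) ^ n • (π γ (v n) - v n)) 2 := fun γ => by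
    obtain ⟨m, rfl⟩ := hf γ
    refine memℓp_gen (Summable.of_norm_bounded_eventually_nat
      (g := fun n => (1 / 4 : ℝ) ^ n) (summable_geometric_of_lt_one (by norm_num) (by norm_num)) ?_)
    filter_upwards [eventually_gt_atTop m] with n hn
    have h1 := (hvF n (f m) (Finset.mem_image_of_mem f (Finset.mem_range.2 hn))).le
    rw [ENNReal.toReal_ofNat, Real.rpow_ofNat, norm_pow, norm_norm, norm_smul, norm_pow,
      Complex.norm_ofNat]
    calc (2 ^ n * ‖π (f m) (v n) - v n‖) ^ 2 ≤ (2 ^ n * (1 / 4) ^ n) ^ 2 := by gcongr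
      _ = (1 / 4) ^ n := by rw [← mul_pow, ← pow_mul, mul_comm n, pow_mul]; norm_num
  let b : Γ → lp (fun _ : ℕ => H) 2 := fun γ => ⟨_, hmem γ⟩
  have hb : ∀ γ n, b γ n = (2 : ℂ) ^ n • (π γ (v n) - v n) := fun γ n => rfl
  refine ⟨lp (fun _ : ℕ => H) 2, inferInstance, .complexToReal, b, fun g h => ?_, fun M => ?_⟩
  · rw [lp.norm_eq_tsum_rpow (by norm_num), lp.norm_eq_tsum_rpow (by norm_num)]
    congr 2
    funext n
    congr 1
    have hcomp : π g (π (g⁻¹ * h) (v n)) = π h (v n) := by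
      change (π g * π (g⁻¹ * h)) (v n) = _
      rw [← map_mul, mul_inv_cancel_left]
    rw [lp.coeFn_sub, Pi.sub_apply, hb, hb, hb, ← smul_sub, sub_sub_sub_cancel_right, norm_smul,
      norm_smul, ← LinearIsometryEquiv.norm_map (π g) (π (g⁻¹ * h) (v n) - v n), map_sub,
      hcomp, norm_sub_rev]
  · by_contra! hM
    have hM0 : 0 ≤ M := (norm_nonneg _).trans (hM 1)
    obtain ⟨n, hn⟩ := pow_unbounded_of_one_lt (2 * M) one_lt_two
    obtain ⟨u, hu0, hu⟩ := exists_ne_zero_forall_apply_eq_of_norm_sub_le π (hv n) fun γ => by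
      have h1 := (lp.norm_apply_le_norm (by norm_num) (b γ) n).trans (hM γ)
      rw [hb, norm_smul, norm_pow, Complex.norm_ofNat] at h1
      by_contra! h2
      have : (2 : ℝ) ^ n * (1 / 2) ≤ 2 ^ n * ‖π γ (v n) - v n‖ := by gcongr
      linarith
    exact hno ⟨u, hu0, hu⟩

end UnboundedCocycle
section GaussianKernel

open Finsupp

/-- The Gaussian kernels `exp (-t² ‖b g - b h‖² / 2)` of a countable family of vectors are realized
by mutually orthogonal families of vectors in a real Hilbert space. -/
theorem exists_inner_eq_ite_exp {α : Type} {E : Type*} [NormedAddCommGroup E]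
    [InnerProductSpace ℝ E] [Countable α] (b : α → E) (t : ℕ → ℝ) :
    ∃ (F : Type) (_ : NormedAddCommGroup F) (_ : InnerProductSpace ℝ F) (w : ℕ × α → F),
      ∀ i j, inner ℝ (w i) (w j) =
        if i.1 = j.1 then Real.exp (-((t i.1 * ‖b i.2 - b j.2‖) ^ 2 / 2)) else 0 := by
  obtain ⟨P, hP, hbP⟩ := exists_isGaussianLawOf b
  let f : ℕ × α → (α → ℝ) → ℂ := fun i x =>
    Complex.exp (linearCombination ℝ x (Finsupp.single i.2 (t i.1)) * Complex.I)
  have hf : ∀ i, MemLp (f i) 2 P := fun i =>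
    .of_bound (measurable_cexp_linearCombination _).aestronglyMeasurable 1
      (.of_forall fun x => (norm_cexp_linearCombination _ x).le)
  have hinner : ∀ m g h, inner ℝ ((hf (m, g)).toLp (f (m, g))) ((hf (m, h)).toLp (f (m, h))) =
      Real.exp (-((t m * ‖b g - b h‖) ^ 2 / 2)) := fun m g h => by
    have h1 : (fun x => inner ℝ ((hf (m, g)).toLp (f (m, g)) x)
        ((hf (m, h)).toLp (f (m, h)) x)) =ᵐ[P] fun x =>
        RCLike.re (Complex.exp (linearCombination ℝ x
          (Finsupp.single h (t m) - Finsupp.single g (t m)) * Complex.I)) := by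
      filter_upwards [(hf (m, g)).coeFn_toLp, (hf (m, h)).coeFn_toLp] with x hg hh
      rw [hg, hh, ← conj_cexp_mul_cexp, Complex.inner, mul_comm]
      rfl
    rw [L2.inner_def, integral_congr_ae h1, integral_re (integrable_cexp_linearCombination _), hbP,
      map_sub, linearCombination_single, linearCombination_single, ← smul_sub, norm_smul, mul_pow,
      mul_pow, Real.norm_eq_abs, sq_abs, norm_sub_rev, ← Complex.ofReal_neg,
      ← Complex.ofReal_exp]
    exact Complex.ofReal_re _
  refine ⟨lp (fun _ : ℕ => Lp ℂ 2 P) 2, inferInstance, inferInstance,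
    fun i => lp.single 2 i.1 ((hf i).toLp (f i)), ?_⟩
  rintro ⟨m, g⟩ ⟨n, h⟩
  rw [lp.inner_single_left]
  by_cases hmn : m = n
  · subst hmn
    rw [if_pos rfl, lp.single_apply_self, hinner]
  · rw [if_neg hmn, lp.single_apply_ne _ _ _ hmn, inner_zero_right]

end GaussianKernel

/-- A countable group without property (T) has an ergodic Gaussian action on a non-atomic standard
probability space which is not strongly ergodic. -/
theorem exists_isErgodic_not_stronglyErgodic {Γ : Type} [Group Γ] [Countable Γ]
    (hT : ¬ HasPropertyT Γ) :
    ∃ (μ : Measure (ℕ × Γ → ℝ)) (_ : IsProbabilityMeasure μ) (_ : NullSingletonClass μ)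
      (A : PMPAction Γ (ℕ × Γ → ℝ) μ), A.IsErgodic ∧ ¬ A.StronglyErgodic := by
  obtain ⟨E, _, _, b, hb, hb_unbdd⟩ := exists_unbounded_of_not_hasPropertyT hT
  choose γ hγ using fun k : ℕ => hb_unbdd k
  obtain ⟨F, _, _, w, hw⟩ := exists_inner_eq_ite_exp b fun m => ((m : ℝ) + 1)⁻¹
  let _ : MulAction Γ (ℕ × Γ) :=
    { smul := fun g i => (i.1, g * i.2)
      one_smul := fun i => Prod.ext rfl (one_mul _)
      mul_smul := fun g h i => Prod.ext rfl (mul_assoc g h _) }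
  have smul_def : ∀ (g : Γ) (i : ℕ × Γ), g • i = (i.1, g * i.2) := fun _ _ => rfl
  have hw_inv : ∀ (g : Γ) i j, inner ℝ (w (g • i)) (w (g • j)) = inner ℝ (w i) (w j) :=
    fun g i j => by
      simp only [hw, smul_def, hb (g * i.2), hb i.2, mul_inv_rev, mul_assoc, inv_mul_cancel_left]
  have hw_norm : ∀ i, ‖w i‖ = 1 := fun i => by
    rw [← sq_eq_sq₀ (norm_nonneg _) zero_le_one, ← real_inner_self_eq_norm_sq, hw]
    simp
  obtain ⟨μ, _, hμ⟩ := exists_isGaussianLawOf w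
  have h_atoms : NullSingletonClass μ := by
    refine ⟨fun x => ?_⟩
    have h0 := ProbabilityTheory.nullSingletonClass_gaussianReal (μ := 0) (v := 1) one_ne_zero
    have h1 : ProbabilityTheory.gaussianReal 0 1 {x (0, 1)} = 0 := measure_singleton _
    rw [← hμ.map_eval (0, 1) (hw_norm _), Measure.map_apply (measurable_pi_apply ((0 : ℕ), (1 : Γ)))
      (measurableSet_singleton _)] at h1
    exact measure_mono_null (by rintro _ rfl; rfl) h1
  refine ⟨μ, inferInstance, h_atoms, gaussianAction hμ hw_inv,
    isErgodic_gaussianAction hμ hw_inv γ fun i j => ?_,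
    not_stronglyErgodic_gaussianAction hμ hw_inv (fun n => (n, 1)) (fun n => hw_norm _)
      fun g => ?_⟩
  · simp only [hw, smul_def]
    by_cases hij : i.1 = j.1
    · simp only [if_pos hij]
      have hlow : ∀ k : ℕ, (k : ℝ) + (-‖b i.2‖ - ‖b j.2⁻¹‖) ≤ ‖b i.2 - b (γ k * j.2)‖ := fun k => by
        have h1 : ‖b (γ k * j.2) - b (γ k)‖ = ‖b j.2⁻¹‖ := by
          rw [hb]
          congr 2
          group
        have h2 := norm_sub_norm_le (b (γ k)) (b i.2)
        have h3 := norm_sub_le_norm_sub_add_norm_sub (b i.2) (b (γ k * j.2)) (b (γ k))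
        rw [norm_sub_rev (b i.2) (b (γ k))] at h3
        linarith [hγ k]
      have hlim : Tendsto (fun k => ‖b i.2 - b (γ k * j.2)‖) atTop atTop :=
        tendsto_atTop_mono hlow
          (tendsto_atTop_add_const_right _ _ tendsto_natCast_atTop_atTop)
      have h4 : Tendsto (fun k => (((i.1 : ℝ) + 1)⁻¹ * ‖b i.2 - b (γ k * j.2)‖) ^ 2 / 2) atTop
          atTop :=
        ((tendsto_pow_atTop two_ne_zero).comp
          (hlim.const_mul_atTop (by positivity))).atTop_div_const two_pos
      exact Real.tendsto_exp_neg_atTop_nhds_zero.comp h4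
    · simp only [if_neg hij]
      exact tendsto_const_nhds
  · have h1 : ∀ n : ℕ, ‖w (g • (n, 1)) - w (n, 1)‖ =
        √(2 - 2 * Real.exp (-((((n : ℝ) + 1)⁻¹ * ‖b g - b 1‖) ^ 2 / 2))) := fun n => by
      rw [← Real.sqrt_sq (norm_nonneg (w (g • (n, 1)) - w (n, 1))), norm_sub_sq_real, hw_norm,
        hw_norm, hw, smul_def, if_pos rfl, mul_one]
      congr 1
      ring
    simp only [h1]
    have h2 : Tendsto (fun n : ℕ => ((n : ℝ) + 1)⁻¹) atTop (𝓝 0) := by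
      simpa using tendsto_one_div_add_atTop_nhds_zero_nat (𝕜 := ℝ)
    have h3 : Continuous fun r : ℝ => √(2 - 2 * Real.exp (-((r * ‖b g - b 1‖) ^ 2 / 2))) := by
      fun_prop
    have h4 : √(2 - 2 * Real.exp (-((0 * ‖b g - b 1‖) ^ 2 / 2))) = 0 := by simp
    rw [← h4]
    exact (h3.tendsto 0).comp h2

/-- **Connes–Weiss / Schmidt.** A countable infinite group has Kazhdan's property (T) if and
only if every ergodic p.m.p. action of it on a standard non-atomic probability space is
strongly ergodic. -/
theorem hasPropertyT_iff_every_ergodic_action_stronglyErgodic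
    (Γ : Type) [Group Γ] [Countable Γ] [Infinite Γ] :
    HasPropertyT Γ ↔
      ∀ (X : Type) (_ : MeasurableSpace X),
        StandardBorelSpace X →
        ∀ (μ : Measure X), IsProbabilityMeasure μ → NoAtoms μ →
          ∀ A : PMPAction Γ X μ, A.IsErgodic → A.StronglyErgodic := by
  refine ⟨fun hT X _ _ μ _ _ A hA => hA.stronglyErgodic hT, fun h => ?_⟩
  by_contra hT
  obtain ⟨μ, hμ, hμ0, A, hA, hA'⟩ := exists_isErgodic_not_stronglyErgodic hT
  exact hA' (h _ inferInstance inferInstance μ hμ hμ0 A hA)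
end
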